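/- arXiv:2504.03579 — 4 statements merged into one kernel-verified Lean document; each statement's English description precedes it below -/
import Mathlib

section
/- Let K ≥ 1, let α = (α₁,…,α_K) with each α_k > 0 and α₀ = Σ_{k=1}^K α_k, let b ~ Dirichlet(α), and let h = H(b) = −Σ_{k=1}^K b_k log b_k be the Shannon entropy of the random probability vector b. Then the expected entropy satisfies E[h] = ψ(α₀ + 1) − Σ_{i=1}^K (α_i / α₀) ψ(α_i + 1), where ψ is the digamma function. -/
open MeasureTheory Finset

/-- The digamma function `ψ(x) = d/dx log Γ(x)`. -/
noncomputable def digamma (x : ℝ) : ℝ := deriv (fun y => Real.log (Real.Gamma y)) x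

/-- The trigamma function `ψ₁(x) = ψ′(x)`. -/
noncomputable def trigamma (x : ℝ) : ℝ := deriv digamma x

/-- The Dirichlet density `p(b|α) = (Γ(α₀)/∏ Γ(α_k)) ∏ b_k^(α_k - 1)` with `α₀ = ∑ α_k`. -/
noncomputable def dirDensity {K : ℕ} (α : Fin K → ℝ) (b : Fin K → ℝ) : ℝ :=
  (Real.Gamma (∑ k, α k) / ∏ k, Real.Gamma (α k)) * ∏ k, b k ^ (α k - 1)

/-- Parametrization of the probability simplex in `ℝ^K` by its first `K - 1` coordinates:
the last coordinate is `1 - ∑ x_j`. -/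
noncomputable def extendSimplex (K : ℕ) (x : Fin (K - 1) → ℝ) : Fin K → ℝ :=
  fun i => if h : (i : ℕ) < K - 1 then x ⟨i, h⟩ else 1 - ∑ j, x j

/-- The coordinate chart of the simplex: nonnegative vectors in `ℝ^(K-1)` with sum at most 1. -/
def simplexChart (K : ℕ) : Set (Fin (K - 1) → ℝ) :=
  {x | (∀ j, 0 ≤ x j) ∧ ∑ j, x j ≤ 1}

/-- Expectation of `f` under the `Dirichlet α` distribution: the integral of `f` against the
Dirichlet density with respect to the (K−1)-dimensional Lebesgue measure on the simplex. -/
noncomputable def dirExp {K : ℕ} (α : Fin K → ℝ) (f : (Fin K → ℝ) → ℝ) : ℝ :=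
  ∫ x in simplexChart K, f (extendSimplex K x) * dirDensity α (extendSimplex K x)


noncomputable def gr (a t : ℝ) : ℝ := (Set.Ioi (0:ℝ)).indicator (fun t => t ^ (a - 1)) t

lemma gr_nonneg (a t : ℝ) : 0 ≤ gr a t :=
  Set.indicator_nonneg (fun _ hx => Real.rpow_nonneg (le_of_lt hx) _) _

lemma gr_of_pos (a : ℝ) {t : ℝ} (h : 0 < t) : gr a t = t ^ (a - 1) :=
  Set.indicator_of_mem (show t ∈ Set.Ioi (0:ℝ) from h) _

lemma gr_of_nonpos (a : ℝ) {t : ℝ} (h : t ≤ 0) : gr a t = 0 :=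
  Set.indicator_of_notMem (by simpa using h) _

@[fun_prop]
lemma gr_meas (a : ℝ) : Measurable (gr a) :=
  (by fun_prop : Measurable (fun t : ℝ => t ^ (a - 1))).indicator measurableSet_Ioi

lemma gr_mul (a : ℝ) {s : ℝ} (hs : 0 < s) (t : ℝ) : gr a (s * t) = s ^ (a - 1) * gr a t := by
  rcases le_or_gt t 0 with h | h
  · rw [gr_of_nonpos a h, gr_of_nonpos a (mul_nonpos_of_nonneg_of_nonpos hs.le h), mul_zero]
  · rw [gr_of_pos a h, gr_of_pos a (mul_pos hs h), Real.mul_rpow hs.le h.le]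

lemma gr_exp_eq (a : ℝ) : (fun t => Real.exp (-t) * gr a t)
    = (Set.Ioi (0:ℝ)).indicator (fun t => Real.exp (-t) * t ^ (a - 1)) := by
  ext t
  rcases le_or_gt t 0 with h | h
  · rw [gr_of_nonpos a h, Set.indicator_of_notMem (by simpa using h), mul_zero]
  · rw [gr_of_pos a h, Set.indicator_of_mem (by simpa using h)]

lemma gr_int {a : ℝ} (ha : 0 < a) : Integrable (fun t => Real.exp (-t) * gr a t) := by
  rw [gr_exp_eq, integrable_indicator_iff measurableSet_Ioi]
  exact Real.GammaIntegral_convergent ha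

lemma gr_integral {a : ℝ} (ha : 0 < a) : ∫ t, Real.exp (-t) * gr a t = Real.Gamma a := by
  rw [gr_exp_eq, integral_indicator measurableSet_Ioi, Real.Gamma_eq_integral ha]

lemma gr_lint {a : ℝ} (ha : 0 < a) :
    ∫⁻ t, ENNReal.ofReal (Real.exp (-t) * gr a t) = ENNReal.ofReal (Real.Gamma a) := by
  rw [← gr_integral ha, ofReal_integral_eq_lintegral_ofReal (gr_int ha)]
  exact Filter.Eventually.of_forall fun t => mul_nonneg (Real.exp_pos _).le (gr_nonneg _ _)

noncomputable def PP {n : ℕ} (a : Fin n → ℝ) (β : ℝ) (s : ℝ) (y : Fin n → ℝ) : ℝ :=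
  (∏ i, gr (a i) (y i)) * gr β (s - ∑ i, y i)

lemma PP_nonneg {n : ℕ} (a : Fin n → ℝ) (β s : ℝ) (y : Fin n → ℝ) : 0 ≤ PP a β s y :=
  mul_nonneg (Finset.prod_nonneg fun _ _ => gr_nonneg _ _) (gr_nonneg _ _)

@[fun_prop]
lemma PP_meas {n : ℕ} (a : Fin n → ℝ) (β : ℝ) :
    Measurable (fun p : ℝ × (Fin n → ℝ) => PP a β p.1 p.2) := by
  unfold PP; fun_prop

lemma PP_meas2 {n : ℕ} (a : Fin n → ℝ) (β s : ℝ) : Measurable (PP a β s) := by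
  unfold PP; fun_prop

lemma PP_of_nonpos {n : ℕ} (a : Fin n → ℝ) (β : ℝ) {s : ℝ} (hs : s ≤ 0) (y : Fin n → ℝ) :
    PP a β s y = 0 := by
  unfold PP
  by_cases h : ∃ i, y i ≤ 0
  · obtain ⟨i, hi⟩ := h
    rw [Finset.prod_eq_zero (Finset.mem_univ i) (gr_of_nonpos _ hi), zero_mul]
  · push Not at h
    have : 0 ≤ ∑ i, y i := Finset.sum_nonneg fun i _ => (h i).le
    rw [gr_of_nonpos β (by linarith), mul_zero]

lemma PP_smul {n : ℕ} (a : Fin n → ℝ) (β : ℝ) {s : ℝ} (hs : 0 < s) (x : Fin n → ℝ) :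
    PP a β s (s • x) = s ^ ((∑ i, a i) + β - 1 - n) * PP a β 1 x := by
  unfold PP
  have h1 : s - ∑ i, (s • x) i = s * (1 - ∑ i, x i) := by
    simp [← Finset.mul_sum]; ring
  rw [h1, gr_mul β hs]
  simp only [Pi.smul_apply, smul_eq_mul, gr_mul _ hs, Finset.prod_mul_distrib]
  rw [← Real.rpow_sum_of_pos hs]
  have : (∑ i, a i) + β - 1 - n = (∑ i, (a i - 1)) + (β - 1) := by simp; ring
  rw [this, Real.rpow_add hs]; ring

lemma lint_smul {n : ℕ} {s : ℝ} (hs : 0 < s) (f : (Fin n → ℝ) → ENNReal) (hf : Measurable f) :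
    ∫⁻ y, f y = ENNReal.ofReal (s ^ n) * ∫⁻ x, f (s • x) := by
  have h := Measure.map_addHaar_smul (volume : Measure (Fin n → ℝ)) hs.ne'
  rw [← lintegral_map hf (measurable_const_smul s), h, lintegral_smul_measure, smul_eq_mul,
    ← mul_assoc, ← ENNReal.ofReal_mul (by positivity)]
  simp only [Module.finrank_fin_fun]
  rw [abs_of_pos (by positivity), mul_inv_cancel₀ (by positivity)]
  simp

lemma PP_lint_s {n : ℕ} (a : Fin n → ℝ) (β : ℝ) (s : ℝ) :
    ∫⁻ y, ENNReal.ofReal (PP a β s y)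
      = ENNReal.ofReal (gr (∑ i, a i + β) s) * ∫⁻ y, ENNReal.ofReal (PP a β 1 y) := by
  rcases le_or_gt s 0 with hs | hs
  · simp [PP_of_nonpos a β hs, gr_of_nonpos _ hs]
  · rw [lint_smul hs _ (PP_meas2 a β s).ennreal_ofReal]
    simp only [PP_smul a β hs]
    simp only [ENNReal.ofReal_mul (Real.rpow_nonneg hs.le _)]
    rw [lintegral_const_mul _ (PP_meas2 a β 1).ennreal_ofReal, ← mul_assoc,
      ← ENNReal.ofReal_mul (by positivity), gr_of_pos _ hs, ← Real.rpow_natCast,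
      ← Real.rpow_add hs]
    have : (n : ℝ) + (∑ i, a i + β - 1 - n) = ∑ i, a i + β - 1 := by ring
    rw [this]

lemma PP_key {n : ℕ} (a : Fin n → ℝ) (β : ℝ) (ha : ∀ i, 0 < a i) (hβ : 0 < β) :
    ENNReal.ofReal (Real.Gamma (∑ i, a i + β)) * ∫⁻ y, ENNReal.ofReal (PP a β 1 y)
      = ENNReal.ofReal ((∏ i, Real.Gamma (a i)) * Real.Gamma β) := by
  have hA : 0 < ∑ i, a i + β := add_pos_of_nonneg_of_pos (sum_nonneg fun i _ => (ha i).le) hβ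
  have hnn : ∀ y : Fin n → ℝ, 0 ≤ ∏ i, (Real.exp (-(y i)) * gr (a i) (y i)) := fun y =>
    Finset.prod_nonneg fun i _ => mul_nonneg (Real.exp_pos _).le (gr_nonneg _ _)
  have hprod : ∫⁻ y : Fin n → ℝ, ENNReal.ofReal (∏ i, (Real.exp (-(y i)) * gr (a i) (y i)))
      = ENNReal.ofReal (∏ i, Real.Gamma (a i)) := by
    rw [← ofReal_integral_eq_lintegral_ofReal]
    · rw [integral_fintype_prod_volume_eq_prod (fun i t => Real.exp (-t) * gr (a i) t)]
      simp only [gr_integral (ha _)]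
    · exact Integrable.fintype_prod (f := fun i t => Real.exp (-t) * gr (a i) t)
        (fun i => gr_int (ha i))
    · exact Filter.Eventually.of_forall hnn
  rw [← gr_lint hA, ← lintegral_mul_const _ (by fun_prop)]
  have e1 : ∀ s : ℝ, ENNReal.ofReal (Real.exp (-s) * gr (∑ i, a i + β) s) *
      ∫⁻ y, ENNReal.ofReal (PP a β 1 y)
      = ∫⁻ y, ENNReal.ofReal (Real.exp (-s) * PP a β s y) := by
    intro s
    simp only [ENNReal.ofReal_mul (Real.exp_pos (-s)).le]
    rw [lintegral_const_mul _ (PP_meas2 a β s).ennreal_ofReal, PP_lint_s a β s, mul_assoc]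
  simp only [e1]
  rw [lintegral_lintegral_swap (by fun_prop)]
  have e2 : ∀ y : Fin n → ℝ, ∫⁻ s, ENNReal.ofReal (Real.exp (-s) * PP a β s y)
      = ENNReal.ofReal (∏ i, (Real.exp (-(y i)) * gr (a i) (y i))) *
        ENNReal.ofReal (Real.Gamma β) := by
    intro y
    rw [← gr_lint hβ, ← lintegral_sub_right_eq_self (fun t => ENNReal.ofReal (Real.exp (-t) * gr β t)) (∑ i, y i),
      ← lintegral_const_mul _ (by fun_prop)]
    congr 1; ext s
    rw [← ENNReal.ofReal_mul (hnn y)]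
    congr 1
    rw [Finset.prod_mul_distrib, ← Real.exp_sum]
    unfold PP
    have : Real.exp (-s) = Real.exp (∑ i, -y i) * Real.exp (-(s - ∑ i, y i)) := by
      rw [← Real.exp_add]; congr 1; simp only [Finset.sum_neg_distrib]; ring
    rw [this]; ring
  simp only [e2]
  rw [lintegral_mul_const _ (by fun_prop), hprod, ← ENNReal.ofReal_mul]
  exact Finset.prod_nonneg fun i _ => (Real.Gamma_pos_of_pos (ha i)).le

lemma PP_integrable_integral {n : ℕ} (a : Fin n → ℝ) (β : ℝ) (ha : ∀ i, 0 < a i) (hβ : 0 < β) :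
    Integrable (PP a β 1) ∧ ∫ y, PP a β 1 y
      = (∏ i, Real.Gamma (a i)) * Real.Gamma β / Real.Gamma (∑ i, a i + β) := by
  have hA : 0 < ∑ i, a i + β := add_pos_of_nonneg_of_pos (sum_nonneg fun i _ => (ha i).le) hβ
  have hG := Real.Gamma_pos_of_pos hA
  have h : ∫⁻ y, ENNReal.ofReal (PP a β 1 y)
      = ENNReal.ofReal ((∏ i, Real.Gamma (a i)) * Real.Gamma β / Real.Gamma (∑ i, a i + β)) := by
    rw [ENNReal.ofReal_div_of_pos hG, ← PP_key a β ha hβ, mul_comm,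
      ENNReal.mul_div_cancel_right (by simpa using hG) ENNReal.ofReal_ne_top]
  have hm : AEStronglyMeasurable (PP a β 1) volume := (PP_meas2 a β 1).aestronglyMeasurable
  have hn : 0 ≤ᵐ[volume] PP a β 1 := Filter.Eventually.of_forall (PP_nonneg a β 1)
  constructor
  · refine ⟨hm, ?_⟩
    rw [hasFiniteIntegral_iff_ofReal hn, h]
    exact ENNReal.ofReal_lt_top
  · rw [integral_eq_lintegral_of_nonneg_ae hn hm, h, ENNReal.toReal_ofReal]
    exact div_nonneg (mul_nonneg (Finset.prod_nonneg fun i _ => (Real.Gamma_pos_of_pos (ha i)).le)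
      (Real.Gamma_pos_of_pos hβ).le) hG.le

lemma ext_castSucc {n : ℕ} (x : Fin n → ℝ) (i : Fin n) :
    extendSimplex (n + 1) x i.castSucc = x i := by
  simp [extendSimplex]

lemma ext_last {n : ℕ} (x : Fin n → ℝ) :
    extendSimplex (n + 1) x (Fin.last n) = 1 - ∑ j, x j := by
  simp [extendSimplex]

lemma chart_meas (n : ℕ) : MeasurableSet (simplexChart (n + 1)) := by
  have h : MeasurableSet ((⋂ j : Fin n, {x : Fin n → ℝ | 0 ≤ x j}) ∩
      {x : Fin n → ℝ | ∑ j, x j ≤ 1}) :=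
    (MeasurableSet.iInter fun j => measurableSet_le measurable_const
      (measurable_pi_apply j)).inter (measurableSet_le (by fun_prop) measurable_const)
  have e : simplexChart (n + 1) = ((⋂ j : Fin n, {x : Fin n → ℝ | 0 ≤ x j}) ∩
      {x : Fin n → ℝ | ∑ j, x j ≤ 1}) := by
    ext x
    simp only [Set.mem_inter_iff, Set.mem_iInter]
    rfl
  rw [e]; exact h

lemma ae_sum_ne (n : ℕ) : ∀ᵐ x : Fin n → ℝ, ∑ j, x j ≠ 1 := by
  rcases n with _ | n
  · simp
  · let S : AffineSubspace ℝ (Fin (n + 1) → ℝ) :=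
      { carrier := {x | ∑ j, x j = 1}
        smul_vsub_vadd_mem' := by
          intro c p q r hp hq hr
          simp only [Set.mem_ofPred_eq] at *
          simp [Finset.sum_add_distrib, ← Finset.mul_sum, hp, hq, hr] }
    have h := Measure.addHaar_affineSubspace (volume : Measure (Fin (n + 1) → ℝ)) S (by
      intro h
      have : (0 : Fin (n + 1) → ℝ) ∈ S := h ▸ AffineSubspace.mem_top _ _ _
      have h2 : ∑ j, (0 : Fin (n + 1) → ℝ) j = 1 := this
      simp at h2)
    rw [ae_iff]
    convert h using 2
    ext x; simp; rfl

lemma ae_chart (n : ℕ) : ∀ᵐ x ∂(volume.restrict (simplexChart (n + 1))),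
    ∀ k, 0 < extendSimplex (n + 1) x k ∧ extendSimplex (n + 1) x k ≤ 1 := by
  have h1 : ∀ᵐ x : Fin n → ℝ, ∀ j, x j ≠ 0 := by
    rw [ae_all_iff]
    intro j
    exact Measure.pi_hyperplane (fun _ : Fin n => (volume : Measure ℝ)) j 0 |> compl_mem_ae_iff.2
  rw [ae_restrict_iff' (chart_meas n)]
  filter_upwards [h1, ae_sum_ne n] with x hx hs hc
  obtain ⟨h0, hle⟩ := hc
  intro k
  refine Fin.lastCases ?_ (fun i => ?_) k
  · rw [ext_last]
    have h2 : 0 ≤ ∑ j : Fin n, x j := Finset.sum_nonneg fun j _ => h0 j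
    exact ⟨sub_pos.2 (lt_of_le_of_ne hle hs), sub_le_self _ h2⟩
  · rw [ext_castSucc]
    exact ⟨lt_of_le_of_ne (h0 i) (hx i).symm,
      (Finset.single_le_sum (fun j _ => h0 j) (Finset.mem_univ i)).trans hle⟩

lemma ext_meas {n : ℕ} (k : Fin (n + 1)) :
    Measurable (fun x : Fin n → ℝ => extendSimplex (n + 1) x k) := by
  refine Fin.lastCases ?_ (fun i => ?_) k
  · simp only [ext_last]; fun_prop
  · simp only [ext_castSucc]; fun_prop

lemma dir_base {n : ℕ} (α : Fin (n + 1) → ℝ) (hα : ∀ k, 0 < α k) :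
    IntegrableOn (fun x : Fin n → ℝ => ∏ k, extendSimplex (n + 1) x k ^ (α k - 1))
      (simplexChart (n + 1)) ∧
    ∫ x in simplexChart (n + 1), ∏ k, extendSimplex (n + 1) x k ^ (α k - 1)
      = (∏ k, Real.Gamma (α k)) / Real.Gamma (∑ k, α k) := by
  obtain ⟨hi, hv⟩ := PP_integrable_integral (fun i : Fin n => α i.castSucc) (α (Fin.last n))
    (fun i => hα _) (hα _)
  have hae : (PP (fun i : Fin n => α i.castSucc) (α (Fin.last n)) 1)
      =ᵐ[volume.restrict (simplexChart (n + 1))]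
      (fun x : Fin n → ℝ => ∏ k, extendSimplex (n + 1) x k ^ (α k - 1)) := by
    filter_upwards [ae_chart n] with x hx
    rw [Fin.prod_univ_castSucc, PP]
    congr 1
    · refine Finset.prod_congr rfl fun i _ => ?_
      have := (hx i.castSucc).1
      rw [ext_castSucc] at this ⊢
      rw [gr_of_pos _ this]
    · have := (hx (Fin.last n)).1
      rw [ext_last] at this ⊢
      exact gr_of_pos _ this
  constructor
  · exact (hi.integrableOn (s := simplexChart (n + 1))).congr hae
  · rw [← integral_congr_ae hae, setIntegral_eq_integral_of_forall_compl_eq_zero,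
      Fin.prod_univ_castSucc, Fin.sum_univ_castSucc]
    · exact hv
    intro x hx
    unfold PP
    by_cases h : ∃ i, x i ≤ 0
    · obtain ⟨i, hi⟩ := h
      rw [Finset.prod_eq_zero (Finset.mem_univ i) (gr_of_nonpos _ hi), zero_mul]
    · push Not at h
      have : ¬ (∑ j, x j ≤ 1) := fun h1 => hx ⟨fun j => (h j).le, h1⟩
      rw [gr_of_nonpos _ (by linarith), mul_zero]

lemma hasDerivAt_Gamma' {x : ℝ} (hx : 0 < x) :
    HasDerivAt Real.Gamma (digamma x * Real.Gamma x) x := by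
  have hd : DifferentiableAt ℝ Real.Gamma x := Real.differentiableAt_Gamma (fun m h => by
    have : (0:ℝ) ≤ m := m.cast_nonneg
    linarith)
  have hG := Real.Gamma_pos_of_pos hx
  have h := hd.hasDerivAt
  have : digamma x = deriv Real.Gamma x / Real.Gamma x := (h.log hG.ne').deriv
  rw [this, div_mul_cancel₀ _ hG.ne']
  exact h

lemma dir_log {n : ℕ} (α : Fin (n + 1) → ℝ) (hα : ∀ k, 0 < α k) (k : Fin (n + 1)) :
    IntegrableOn (fun x : Fin n → ℝ => (extendSimplex (n + 1) x k *
        Real.log (extendSimplex (n + 1) x k)) * ∏ j, extendSimplex (n + 1) x j ^ (α j - 1))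
      (simplexChart (n + 1)) ∧
    ∫ x in simplexChart (n + 1), (extendSimplex (n + 1) x k *
        Real.log (extendSimplex (n + 1) x k)) * ∏ j, extendSimplex (n + 1) x j ^ (α j - 1)
      = (∏ j, Real.Gamma (α j)) / Real.Gamma (∑ j, α j) * (α k / ∑ j, α j) *
        (digamma (α k + 1) - digamma (∑ j, α j + 1)) := by
  have hA : 0 < ∑ j, α j := Finset.sum_pos (fun j _ => hα j) Finset.univ_nonempty
  have hms : ∀ s : ℝ, Measurable (fun x : Fin n → ℝ =>
      extendSimplex (n + 1) x k ^ s * ∏ j, extendSimplex (n + 1) x j ^ (α j - 1)) := by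
    intro s
    have := fun j => ext_meas (n := n) j
    fun_prop
  have hF' : Measurable (fun x : Fin n → ℝ => (extendSimplex (n + 1) x k ^ (1:ℝ) *
      Real.log (extendSimplex (n + 1) x k)) * ∏ j, extendSimplex (n + 1) x j ^ (α j - 1)) := by
    have := fun j => ext_meas (n := n) j
    fun_prop
  -- values for nearby exponents
  have hval : ∀ s : ℝ, 0 < s →
      IntegrableOn (fun x : Fin n → ℝ =>
        extendSimplex (n + 1) x k ^ s * ∏ j, extendSimplex (n + 1) x j ^ (α j - 1))
        (simplexChart (n + 1)) ∧
      ∫ x in simplexChart (n + 1),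
        extendSimplex (n + 1) x k ^ s * ∏ j, extendSimplex (n + 1) x j ^ (α j - 1)
      = (∏ j ∈ Finset.univ.erase k, Real.Gamma (α j)) * (Real.Gamma (α k + s) /
          Real.Gamma (∑ j, α j + s)) := by
    intro s hs
    have hb := dir_base (fun j => α j + if j = k then s else 0) (fun j => by
      have := hα j
      split_ifs <;> linarith)
    have hae : (fun x : Fin n → ℝ => ∏ j, extendSimplex (n + 1) x j ^
          ((α j + if j = k then s else 0) - 1))
        =ᵐ[volume.restrict (simplexChart (n + 1))] (fun x : Fin n → ℝ =>
        extendSimplex (n + 1) x k ^ s * ∏ j, extendSimplex (n + 1) x j ^ (α j - 1)) := by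
      filter_upwards [ae_chart n] with x hx
      have : ∀ j, extendSimplex (n + 1) x j ^ ((α j + if j = k then s else 0) - 1)
          = (if j = k then extendSimplex (n + 1) x j ^ s else 1) *
            extendSimplex (n + 1) x j ^ (α j - 1) := by
        intro j
        split_ifs with h
        · rw [← Real.rpow_add (hx j).1]; congr 1; ring
        · simp
      simp only [this, Finset.prod_mul_distrib, Finset.prod_ite_eq', Finset.mem_univ, if_true]
    refine ⟨Integrable.congr hb.1 hae, ?_⟩
    rw [← integral_congr_ae hae, hb.2, Finset.sum_add_distrib,
      ← Finset.mul_prod_erase _ _ (Finset.mem_univ k)]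
    have : ∏ j ∈ Finset.univ.erase k, Real.Gamma (α j + if j = k then s else 0)
        = ∏ j ∈ Finset.univ.erase k, Real.Gamma (α j) :=
      Finset.prod_congr rfl fun j hj => by rw [if_neg (Finset.ne_of_mem_erase hj), add_zero]
    rw [this]
    simp
    ring
  have key := hasDerivAt_integral_of_dominated_loc_of_deriv_le
    (μ := volume.restrict (simplexChart (n + 1))) (x₀ := (1:ℝ)) (s := Set.Ioi (1/2 : ℝ))
    (F := fun s (x : Fin n → ℝ) =>
      extendSimplex (n + 1) x k ^ s * ∏ j, extendSimplex (n + 1) x j ^ (α j - 1))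
    (F' := fun s (x : Fin n → ℝ) => (extendSimplex (n + 1) x k ^ s *
      Real.log (extendSimplex (n + 1) x k)) * ∏ j, extendSimplex (n + 1) x j ^ (α j - 1))
    (bound := fun x : Fin n → ℝ => 2 * ∏ j, extendSimplex (n + 1) x j ^ (α j - 1))
    (Ioi_mem_nhds (by norm_num))
    (Filter.Eventually.of_forall fun s => (hms s).aestronglyMeasurable)
    (hval 1 one_pos).1 hF'.aestronglyMeasurable
    (by
      filter_upwards [ae_chart n] with x hx s hs
      have hs' : (1/2 : ℝ) < s := hs
      obtain ⟨h0, h1⟩ := hx k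
      have hp : 0 ≤ ∏ j, extendSimplex (n + 1) x j ^ (α j - 1) :=
        Finset.prod_nonneg fun j _ => Real.rpow_nonneg (hx j).1.le _
      rw [norm_mul, Real.norm_of_nonneg hp]
      refine mul_le_mul_of_nonneg_right ?_ hp
      have hb := Real.abs_log_mul_self_rpow_lt _ s h0 h1 (by linarith)
      rw [Real.norm_eq_abs, mul_comm]
      refine hb.le.trans ?_
      rw [div_le_iff₀ (by linarith)]
      linarith)
    ((dir_base α hα).1.const_mul 2)
    (by
      filter_upwards [ae_chart n] with x hx s hs
      exact ((Real.hasStrictDerivAt_const_rpow (hx k).1 s).hasDerivAt).mul_const _)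
  obtain ⟨ki, kd⟩ := key
  simp only [Real.rpow_one] at ki kd
  refine ⟨ki, ?_⟩
  have hk1 : 0 < α k + 1 := by linarith [hα k]
  have hA1 : 0 < ∑ j, α j + 1 := by linarith
  have hGA1 := Real.Gamma_pos_of_pos hA1
  have d2 : HasDerivAt (fun s : ℝ => (∏ j ∈ Finset.univ.erase k, Real.Gamma (α j)) *
      (Real.Gamma (α k + s) / Real.Gamma (∑ j, α j + s))) _ 1 :=
    ((HasDerivAt.comp_const_add (α k) 1 (hasDerivAt_Gamma' hk1)).div
      (HasDerivAt.comp_const_add (∑ j, α j) 1 (hasDerivAt_Gamma' hA1)) hGA1.ne').const_mul _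
  have hev : (fun s : ℝ => ∫ x in simplexChart (n + 1),
        extendSimplex (n + 1) x k ^ s * ∏ j, extendSimplex (n + 1) x j ^ (α j - 1))
      =ᶠ[nhds 1] (fun s : ℝ => (∏ j ∈ Finset.univ.erase k, Real.Gamma (α j)) *
      (Real.Gamma (α k + s) / Real.Gamma (∑ j, α j + s))) := by
    filter_upwards [Ioi_mem_nhds (one_pos : (0:ℝ) < 1)] with s hs using (hval s hs).2
  have := kd.unique (d2.congr_of_eventuallyEq hev)
  refine this.trans ?_
  have hG0 := Real.Gamma_pos_of_pos hA
  have hGk := Real.Gamma_pos_of_pos (hα k)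
  rw [← Finset.mul_prod_erase _ _ (Finset.mem_univ k), Real.Gamma_add_one (hα k).ne',
    Real.Gamma_add_one hA.ne']
  field_simp

/-- Expected Shannon entropy of `b ~ Dirichlet(α)`. -/
theorem dirichlet_entropy_mean
    (K : ℕ) (hK : 1 ≤ K) (α : Fin K → ℝ) (hα : ∀ k, 0 < α k) :
    dirExp α (fun b => -∑ k, b k * Real.log (b k))
      = digamma ((∑ k, α k) + 1)
        - ∑ i, (α i / ∑ k, α k) * digamma (α i + 1) := by
  obtain ⟨n, rfl⟩ : ∃ n, K = n + 1 := ⟨K - 1, by omega⟩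
  have hA : 0 < ∑ j, α j := Finset.sum_pos (fun j _ => hα j) Finset.univ_nonempty
  have hG0 := Real.Gamma_pos_of_pos hA
  have hGp : 0 < ∏ j, Real.Gamma (α j) :=
    Finset.prod_pos fun j _ => Real.Gamma_pos_of_pos (hα j)
  have e : dirExp α (fun b => -∑ k, b k * Real.log (b k))
      = ∫ x in simplexChart (n + 1), -(Real.Gamma (∑ k, α k) / ∏ k, Real.Gamma (α k)) *
        ∑ k, (extendSimplex (n + 1) x k *
        Real.log (extendSimplex (n + 1) x k)) * ∏ j, extendSimplex (n + 1) x j ^ (α j - 1) := by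
    unfold dirExp dirDensity
    congr 1; ext x
    rw [← Finset.sum_mul]; ring
  rw [e, integral_const_mul]
  have e2 : ∫ x in simplexChart (n + 1), ∑ k, (extendSimplex (n + 1) x k *
        Real.log (extendSimplex (n + 1) x k)) * ∏ j, extendSimplex (n + 1) x j ^ (α j - 1)
      = ∑ k, (∏ j, Real.Gamma (α j)) / Real.Gamma (∑ j, α j) * (α k / ∑ j, α j) *
        (digamma (α k + 1) - digamma (∑ j, α j + 1)) := by
    refine (integral_finsetSum _ fun k _ => (dir_log α hα k).1).trans ?_
    exact Finset.sum_congr rfl fun k _ => (dir_log α hα k).2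
  rw [e2]
  simp only [mul_assoc]
  rw [← Finset.mul_sum]
  simp only [mul_sub, Finset.sum_sub_distrib]
  rw [← Finset.sum_mul, ← Finset.sum_div, div_self hA.ne']
  field_simp
  ring
end

section
/- Let K ≥ 2, let α = (α₁,…,α_K) with each α_k > 0 and α₀ = Σ_{k=1}^K α_k, and let b ~ Dirichlet(α). Then for all indices i, j ∈ {1,…,K} with i ≠ j, E[ b_i b_j log b_i log b_j ] = (α_i α_j) / (α₀(α₀ + 1)) · { −ψ₁(α₀ + 2) + (ψ(α_i + 1) − ψ(α₀ + 2))(ψ(α_j + 1) − ψ(α₀ + 2)) }, where ψ is the digamma function and ψ₁ is the trigamma function. -/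
open MeasureTheory Finset

theorem aux_hasDerivAt_rpow (b p : ℝ) (hb : 0 ≤ b) (hp : 0 < p) :
    HasDerivAt (fun s : ℝ => b ^ s) (b ^ p * Real.log b) p := by
  rcases hb.eq_or_lt with rfl | hb
  · have : (fun s : ℝ => (0:ℝ) ^ s) =ᶠ[nhds p] fun _ => 0 := by
      filter_upwards [lt_mem_nhds hp] with s hs
      exact Real.zero_rpow hs.ne'
    simpa using (hasDerivAt_const p (0:ℝ)).congr_of_eventuallyEq this
  · simpa using (Real.hasStrictDerivAt_const_rpow hb p).hasDerivAt

theorem aux_bound (b p q : ℝ) (hb : 0 ≤ b) (hb1 : b ≤ 1) (hp : 0 < p) (hpq : p ≤ q) :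
    |b ^ q * Real.log b| ≤ 1 / p := by
  rcases hb.eq_or_lt with rfl | hb
  · simp [hp.le]
  · have h := (Real.abs_log_mul_self_rpow_lt b q hb hb1 (hp.trans_le hpq)).le
    rw [mul_comm]
    exact h.trans (one_div_le_one_div_of_le hp hpq)

theorem aux_deriv {X : Type*} [MeasurableSpace X] (μ : Measure X) (g u : X → ℝ)
    (hg : Integrable g μ) (hu : Measurable u) (hu0 : ∀ᵐ x ∂μ, 0 ≤ u x ∧ u x ≤ 1)
    (p : ℝ) (hp : 0 < p) :
    Integrable (fun x => g x * (u x ^ p * Real.log (u x))) μ ∧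
    HasDerivAt (fun s : ℝ => ∫ x, g x * u x ^ s ∂μ)
      (∫ x, g x * (u x ^ p * Real.log (u x)) ∂μ) p := by
  have hp2 : 0 < p / 2 := by positivity
  refine hasDerivAt_integral_of_dominated_loc_of_deriv_le (μ := μ)
    (F := fun s x => g x * u x ^ s) (F' := fun s x => g x * (u x ^ s * Real.log (u x)))
    (s := Set.Ioi (p/2)) (bound := fun x => |g x| * (1 / (p/2)))
    (Ioi_mem_nhds (by linarith)) ?_ ?_ ?_ ?_ ?_ ?_
  · exact Filter.Eventually.of_forall fun s =>
      hg.aestronglyMeasurable.mul (by fun_prop : Measurable fun x => u x ^ s).aestronglyMeasurable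
  · refine hg.mono
      (hg.aestronglyMeasurable.mul (by fun_prop : Measurable fun x => u x ^ p).aestronglyMeasurable) ?_
    filter_upwards [hu0] with x hx
    rw [norm_mul]
    have : ‖u x ^ p‖ ≤ 1 := by
      rw [Real.norm_of_nonneg (Real.rpow_nonneg hx.1 _)]
      exact Real.rpow_le_one hx.1 hx.2 hp.le
    exact mul_le_of_le_one_right (norm_nonneg _) this
  · exact hg.aestronglyMeasurable.mul
      (by fun_prop : Measurable fun x => u x ^ p * Real.log (u x)).aestronglyMeasurable
  · filter_upwards [hu0] with x hx s hs
    rw [norm_mul, Real.norm_eq_abs, Real.norm_eq_abs]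
    exact mul_le_mul_of_nonneg_left (aux_bound _ _ _ hx.1 hx.2 hp2 (le_of_lt hs)) (abs_nonneg _)
  · exact hg.abs.mul_const _
  · filter_upwards [hu0] with x hx s hs
    exact (aux_hasDerivAt_rpow _ _ hx.1 (hp2.trans hs)).const_mul _

theorem aux_digamma_eq (x : ℝ) (hx : 0 < x) :
    digamma x = deriv Real.Gamma x / Real.Gamma x := by
  have hd : DifferentiableAt ℝ Real.Gamma x :=
    Real.differentiableAt_Gamma fun m => by
      have : (0:ℝ) ≤ m := Nat.cast_nonneg m
      linarith
  exact (hd.hasDerivAt.log (Real.Gamma_pos_of_pos hx).ne').deriv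

theorem aux_hasDerivAt_Gamma (x : ℝ) (hx : 0 < x) :
    HasDerivAt Real.Gamma (Real.Gamma x * digamma x) x := by
  have hd : DifferentiableAt ℝ Real.Gamma x :=
    Real.differentiableAt_Gamma fun m => by
      have : (0:ℝ) ≤ m := Nat.cast_nonneg m
      linarith
  rw [aux_digamma_eq x hx, mul_div_cancel₀ _ (Real.Gamma_pos_of_pos hx).ne']
  exact hd.hasDerivAt

theorem aux_hasDerivAt_digamma (x : ℝ) (hx : 0 < x) :
    HasDerivAt digamma (trigamma x) x := by
  have hopen : IsOpen {z : ℂ | 0 < z.re} := isOpen_lt continuous_const Complex.continuous_re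
  have hne : ∀ z : ℂ, 0 < z.re → ∀ m : ℕ, z ≠ -m := by
    intro z hz m h
    rw [h] at hz
    have : (0:ℝ) ≤ m := Nat.cast_nonneg m
    simp at hz
    linarith
  have hdiff : DifferentiableOn ℂ Complex.Gamma {z : ℂ | 0 < z.re} := fun z hz =>
    (Complex.differentiableAt_Gamma z (hne z hz)).differentiableWithinAt
  have hxm : (x : ℂ) ∈ {z : ℂ | 0 < z.re} := by simpa using hx
  have h1 : DifferentiableAt ℂ Complex.digamma x := by
    have := ((hdiff.deriv hopen).div hdiff fun z hz => Complex.Gamma_ne_zero_of_re_pos hz)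
    exact this.differentiableAt (hopen.mem_nhds hxm)
  have h2 := h1.hasDerivAt.real_of_complex
  have h3 : digamma =ᶠ[nhds x] fun y : ℝ => (Complex.digamma y).re := by
    filter_upwards [lt_mem_nhds hx] with y hy
    have hyd := (Complex.differentiableAt_Gamma (y:ℂ) (hne y (by simpa using hy))).hasDerivAt
    have h4 := hyd.real_of_complex
    simp only [Complex.Gamma_ofReal, Complex.ofReal_re] at h4
    rw [aux_digamma_eq y hy, h4.deriv, Complex.digamma, logDeriv_apply, Complex.Gamma_ofReal,
      Complex.div_ofReal_re]
  exact (h2.congr_of_eventuallyEq h3).differentiableAt.hasDerivAt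

theorem aux_beta_scaled (a b s : ℝ) (ha : 0 < a) (hb : 0 < b) (hs : 0 < s) :
    ∫⁻ x in Set.Ioo 0 s, ENNReal.ofReal (x ^ (a - 1) * (s - x) ^ (b - 1))
      = ENNReal.ofReal (s ^ (a + b - 1) *
          (Real.Gamma a * Real.Gamma b / Real.Gamma (a + b))) := by
  have h := Complex.betaIntegral_scaled (a : ℂ) (b : ℂ) hs
  rw [Complex.betaIntegral_eq_Gamma_mul_div _ _ (by simpa) (by simpa)] at h
  have h1 : ∫ x in (0:ℝ)..s, (x : ℂ) ^ ((a:ℂ) - 1) * ((s : ℂ) - x) ^ ((b:ℂ) - 1)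
      = ∫ x in (0:ℝ)..s, ((x ^ (a - 1) * (s - x) ^ (b - 1) : ℝ) : ℂ) := by
    refine intervalIntegral.integral_congr fun x hx => ?_
    rw [Set.uIcc_of_le hs.le] at hx
    have h2 : 0 ≤ s - x := by linarith [hx.2]

    push_cast [Complex.ofReal_cpow hx.1, Complex.ofReal_cpow h2]
    rfl
  rw [h1, intervalIntegral.integral_ofReal] at h
  have h2 : (∫ x in (0:ℝ)..s, x ^ (a - 1) * (s - x) ^ (b - 1))
      = s ^ (a + b - 1) * (Real.Gamma a * Real.Gamma b / Real.Gamma (a + b)) := by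
    apply Complex.ofReal_injective
    rw [h]
    push_cast [Complex.ofReal_cpow hs.le, Complex.Gamma_ofReal, ← Complex.Gamma_ofReal]
    rfl
  have hpos : 0 < s ^ (a + b - 1) * (Real.Gamma a * Real.Gamma b / Real.Gamma (a + b)) := by
    have := Real.Gamma_pos_of_pos ha
    have := Real.Gamma_pos_of_pos hb
    have := Real.Gamma_pos_of_pos (add_pos ha hb)
    positivity
  rw [intervalIntegral.integral_of_le hs.le, integral_Ioc_eq_integral_Ioo] at h2
  have hint : IntegrableOn (fun x : ℝ => x ^ (a - 1) * (s - x) ^ (b - 1)) (Set.Ioo 0 s) := by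
    by_contra hn
    rw [integral_undef hn] at h2
    linarith
  rw [← h2, ofReal_integral_eq_lintegral_ofReal hint]
  filter_upwards [ae_restrict_mem measurableSet_Ioo] with x hx
  exact mul_nonneg (Real.rpow_nonneg hx.1.le _) (Real.rpow_nonneg (by linarith [hx.2]) _)

theorem aux_meas_set (n : ℕ) (s : ℝ) :
    MeasurableSet {x : Fin n → ℝ | (∀ j, 0 ≤ x j) ∧ ∑ j, x j ≤ s} := by
  apply MeasurableSet.inter
  · show MeasurableSet {x : Fin n → ℝ | ∀ j, 0 ≤ x j}
    rw [Set.ofPred_forall]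
    exact MeasurableSet.iInter fun j => measurableSet_le measurable_const (measurable_pi_apply j)
  · exact measurableSet_le (f := fun x : Fin n → ℝ => ∑ j, x j) (by fun_prop) measurable_const

theorem aux_dirichlet (γ : ℝ) (hγ : 0 < γ) (n : ℕ) : ∀ (β : Fin n → ℝ) (_ : ∀ j, 0 < β j)
    (s : ℝ) (_ : 0 < s),
    ∫⁻ x in {x : Fin n → ℝ | (∀ j, 0 ≤ x j) ∧ ∑ j, x j ≤ s},
      ENNReal.ofReal ((∏ j, x j ^ (β j - 1)) * (s - ∑ j, x j) ^ (γ - 1))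
    = ENNReal.ofReal (s ^ (∑ j, β j + γ - 1) *
        ((∏ j, Real.Gamma (β j)) * Real.Gamma γ / Real.Gamma (∑ j, β j + γ))) := by
  induction n with
  | zero =>
    intro β hβ s hs
    have hg := (Real.Gamma_pos_of_pos hγ).ne'
    have : {x : Fin 0 → ℝ | (∀ j, 0 ≤ x j) ∧ ∑ j, x j ≤ s} = Set.univ := by
      ext x; simp [hs.le]
    rw [this, Measure.restrict_univ]
    simp [hg, lintegral_unique, MeasureTheory.volume_pi]
  | succ n ih =>
    intro β hβ s hs
    have hmp := (volume_preserving_piFinSuccAbove (fun _ : Fin (n+1) => ℝ) 0).symm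
    rw [← lintegral_indicator (aux_meas_set _ _), ← hmp.lintegral_comp_emb
      (MeasurableEquiv.measurableEmbedding _)]
    rw [Measure.volume_eq_prod, lintegral_prod]
    swap
    · apply Measurable.aemeasurable
      have hm1 : Measurable (Set.indicator {x : Fin (n+1) → ℝ | (∀ j, 0 ≤ x j) ∧ ∑ j, x j ≤ s}
          (fun x => ENNReal.ofReal ((∏ j, x j ^ (β j - 1)) * (s - ∑ j, x j) ^ (γ - 1)))) :=
        Measurable.indicator (by fun_prop) (aux_meas_set _ _)
      exact hm1.comp (MeasurableEquiv.piFinSuccAbove (fun _ : Fin (n+1) => ℝ) 0).symm.measurable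
    set c : ℝ := (∏ j : Fin n, Real.Gamma (β j.succ)) * Real.Gamma γ /
      Real.Gamma (∑ j : Fin n, β j.succ + γ) with hc
    have hB : 0 < ∑ j : Fin n, β j.succ + γ :=
      add_pos_of_nonneg_of_pos (Finset.sum_nonneg fun j _ => (hβ _).le) hγ
    have hc0 : 0 ≤ c := by
      have h1 := Finset.prod_nonneg (s := Finset.univ)
        fun (j : Fin n) _ => (Real.Gamma_pos_of_pos (hβ j.succ)).le
      have h2 := Real.Gamma_pos_of_pos hγ
      have h3 := Real.Gamma_pos_of_pos hB
      positivity
    have key : ∀ᵐ x : ℝ, (∫⁻ y : Fin n → ℝ,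
        Set.indicator {x : Fin (n+1) → ℝ | (∀ j, 0 ≤ x j) ∧ ∑ j, x j ≤ s}
          (fun x => ENNReal.ofReal ((∏ j, x j ^ (β j - 1)) * (s - ∑ j, x j) ^ (γ - 1)))
          ((MeasurableEquiv.piFinSuccAbove (fun _ : Fin (n+1) => ℝ) 0).symm (x, y)))
        = Set.indicator (Set.Ioo 0 s) (fun x => ENNReal.ofReal c *
            ENNReal.ofReal (x ^ (β 0 - 1) * (s - x) ^ (∑ j : Fin n, β j.succ + γ - 1))) x := by
      filter_upwards [Measure.ae_ne volume 0, Measure.ae_ne volume s] with x hx0 hxs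
      by_cases hx : x ∈ Set.Ioo 0 s
      · rw [Set.indicator_of_mem hx]
        have hsx : 0 < s - x := by linarith [hx.2]
        have := ih (fun j => β j.succ) (fun j => hβ _) (s - x) hsx
        have h0 : 0 ≤ x ^ (β 0 - 1) := Real.rpow_nonneg hx.1.le _
        rw [← hc] at this
        calc _ = ∫⁻ y : Fin n → ℝ, ENNReal.ofReal (x ^ (β 0 - 1)) *
              Set.indicator {x_1 : Fin n → ℝ | (∀ j, 0 ≤ x_1 j) ∧ ∑ j, x_1 j ≤ s - x}
              (fun y => ENNReal.ofReal ((∏ j, y j ^ (β j.succ - 1)) *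
                (s - x - ∑ j, y j) ^ (γ - 1))) y := by
              refine lintegral_congr fun y => ?_
              have e : (MeasurableEquiv.piFinSuccAbove (fun _ : Fin (n+1) => ℝ) 0).symm (x, y)
                  = Fin.cons x y := by
                simp [MeasurableEquiv.piFinSuccAbove, Fin.insertNthEquiv]
              rw [e]
              by_cases hy : (∀ j, 0 ≤ y j) ∧ ∑ j, y j ≤ s - x
              · rw [Set.indicator_of_mem, Set.indicator_of_mem]
                · rw [← ENNReal.ofReal_mul h0]
                  congr 1
                  simp only [Fin.prod_univ_succ, Fin.sum_univ_succ, Fin.cons_zero, Fin.cons_succ]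
                  rw [mul_assoc, sub_sub]
                · exact hy
                · simp only [Set.mem_ofPred_eq, Fin.forall_fin_succ, Fin.sum_univ_succ,
                    Fin.cons_zero, Fin.cons_succ]
                  exact ⟨⟨hx.1.le, hy.1⟩, by linarith [hy.2]⟩
              · rw [Set.indicator_of_notMem, Set.indicator_of_notMem, mul_zero]
                · exact hy
                · simp only [Set.mem_ofPred_eq, Fin.forall_fin_succ, Fin.sum_univ_succ,
                    Fin.cons_zero, Fin.cons_succ]
                  exact fun h => hy ⟨h.1.2, by linarith [h.2]⟩
          _ = _ := by
              rw [lintegral_const_mul' _ _ ENNReal.ofReal_ne_top,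
                lintegral_indicator (aux_meas_set _ _), this, ← ENNReal.ofReal_mul h0,
                ← ENNReal.ofReal_mul hc0]
              congr 1
              ring
      · rw [Set.indicator_of_notMem hx]
        rw [lintegral_eq_zero_of_ae_eq_zero]
        refine Filter.Eventually.of_forall fun y => ?_
        have e : (MeasurableEquiv.piFinSuccAbove (fun _ : Fin (n+1) => ℝ) 0).symm (x, y)
            = Fin.cons x y := by
          simp [MeasurableEquiv.piFinSuccAbove, Fin.insertNthEquiv]
        beta_reduce
        rw [e]
        apply Set.indicator_of_notMem
        simp only [Set.mem_ofPred_eq, Fin.forall_fin_succ, Fin.sum_univ_succ,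
                    Fin.cons_zero, Fin.cons_succ]
        rintro ⟨⟨h1, h2⟩, h3⟩
        have h4 : 0 ≤ ∑ j, y j := Finset.sum_nonneg fun j _ => h2 j
        exact hx ⟨lt_of_le_of_ne h1 (Ne.symm hx0), lt_of_le_of_ne (by linarith) hxs⟩
    rw [lintegral_congr_ae key, lintegral_indicator measurableSet_Ioo,
      lintegral_const_mul' _ _ ENNReal.ofReal_ne_top,
      aux_beta_scaled (β 0) _ s (hβ 0) hB hs, ← ENNReal.ofReal_mul hc0]
    congr 1
    rw [Fin.sum_univ_succ, Fin.prod_univ_succ, hc, ← add_assoc]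
    have := (Real.Gamma_pos_of_pos hB).ne'
    field_simp

theorem aux_extend_castSucc (n : ℕ) (x : Fin n → ℝ) (k : Fin n) :
    extendSimplex (n+1) x k.castSucc = x k := by
  simp [extendSimplex]

theorem aux_extend_last (n : ℕ) (x : Fin n → ℝ) :
    extendSimplex (n+1) x (Fin.last n) = 1 - ∑ j, x j := by
  simp [extendSimplex]

theorem aux_extend_meas (n : ℕ) (k : Fin (n+1)) :
    Measurable fun x : Fin n → ℝ => extendSimplex (n+1) x k := by
  induction k using Fin.lastCases with
  | last => simp only [aux_extend_last]; fun_prop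
  | cast k => simp only [aux_extend_castSucc]; fun_prop

theorem aux_extend_mem (n : ℕ) (x : Fin n → ℝ) (hx : x ∈ simplexChart (n+1)) (k : Fin (n+1)) :
    0 ≤ extendSimplex (n+1) x k ∧ extendSimplex (n+1) x k ≤ 1 := by
  obtain ⟨h1, h2⟩ : (∀ j : Fin n, 0 ≤ x j) ∧ ∑ j : Fin n, x j ≤ 1 := hx
  induction k using Fin.lastCases with
  | last =>
    rw [aux_extend_last]
    have : 0 ≤ ∑ j, x j := Finset.sum_nonneg fun j _ => h1 j
    constructor <;> linarith
  | cast k =>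
    rw [aux_extend_castSucc]
    exact ⟨h1 k, (Finset.single_le_sum (fun j _ => h1 j) (Finset.mem_univ k)).trans h2⟩

theorem aux_dirichlet_integral (n : ℕ) (β : Fin (n+1) → ℝ) (hβ : ∀ k, 0 < β k) :
    Integrable (fun x : Fin n → ℝ => ∏ k, extendSimplex (n+1) x k ^ (β k - 1))
      (volume.restrict (simplexChart (n+1))) ∧
    ∫ x : Fin n → ℝ in simplexChart (n+1), ∏ k, extendSimplex (n+1) x k ^ (β k - 1)
      = (∏ k, Real.Gamma (β k)) / Real.Gamma (∑ k, β k) := by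
  have hm : MeasurableSet (simplexChart (n+1)) := aux_meas_set n 1
  have h := aux_dirichlet (β (Fin.last n)) (hβ _) n (fun j => β j.castSucc) (fun j => hβ _) 1 one_pos
  rw [← Fin.sum_univ_castSucc, ← Fin.prod_univ_castSucc (fun k => Real.Gamma (β k)),
    Real.one_rpow, one_mul] at h
  have h' : ∫⁻ x : Fin n → ℝ in simplexChart (n+1),
      ENNReal.ofReal (∏ k, extendSimplex (n+1) x k ^ (β k - 1))
      = ENNReal.ofReal ((∏ k, Real.Gamma (β k)) / Real.Gamma (∑ k, β k)) := by
    rw [← h]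
    refine lintegral_congr fun x => ?_
    rw [Fin.prod_univ_castSucc, aux_extend_last]
    simp only [aux_extend_castSucc]
  have hmeas : Measurable (fun x : Fin n → ℝ => ∏ k, extendSimplex (n+1) x k ^ (β k - 1)) :=
    Finset.measurable_prod _ fun k _ => (aux_extend_meas n k).pow_const _
  have hnn : ∀ᵐ x : Fin n → ℝ ∂(volume.restrict (simplexChart (n+1))),
      0 ≤ ∏ k, extendSimplex (n+1) x k ^ (β k - 1) := by
    filter_upwards [ae_restrict_mem hm] with x hx
    exact Finset.prod_nonneg fun k _ => Real.rpow_nonneg (aux_extend_mem n x hx k).1 _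
  constructor
  · refine ⟨hmeas.aestronglyMeasurable, ?_⟩
    rw [hasFiniteIntegral_iff_ofReal hnn]
    exact h'.trans_lt ENNReal.ofReal_lt_top
  · rw [integral_eq_lintegral_of_nonneg_ae hnn hmeas.aestronglyMeasurable]
    refine (congrArg ENNReal.toReal h').trans (ENNReal.toReal_ofReal ?_)
    exact div_nonneg (Finset.prod_nonneg fun k _ => (Real.Gamma_pos_of_pos (hβ k)).le)
      (Real.Gamma_pos_of_pos (Finset.sum_pos (fun k _ => hβ k) ⟨0, Finset.mem_univ _⟩)).le

theorem aux_prod_split {n : ℕ} (i j : Fin n) (hij : i ≠ j) (f : Fin n → ℝ) :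
    ∏ k, f k = f i * (f j * ∏ k ∈ (univ.erase i).erase j, f k) := by
  rw [Finset.mul_prod_erase _ _ (by simp [hij.symm]), Finset.mul_prod_erase _ _ (by simp)]

theorem aux_sum_split {n : ℕ} (i j : Fin n) (hij : i ≠ j) (f : Fin n → ℝ) :
    ∑ k, f k = f i + (f j + ∑ k ∈ (univ.erase i).erase j, f k) := by
  rw [Finset.add_sum_erase _ _ (by simp [hij.symm]), Finset.add_sum_erase _ _ (by simp)]

theorem aux_M (n : ℕ) (α : Fin (n+1) → ℝ) (hα : ∀ k, 0 < α k) (i j : Fin (n+1)) (hij : i ≠ j)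
    (p q : ℝ) (hp : -1 < p) (hq : -1 < q) :
    Integrable (fun x : Fin n → ℝ => (∏ k ∈ (univ.erase i).erase j,
        extendSimplex (n+1) x k ^ (α k - 1)) *
        extendSimplex (n+1) x i ^ p * extendSimplex (n+1) x j ^ q)
      (volume.restrict (simplexChart (n+1))) ∧
    ∫ x : Fin n → ℝ in simplexChart (n+1), (∏ k ∈ (univ.erase i).erase j,
        extendSimplex (n+1) x k ^ (α k - 1)) *
        extendSimplex (n+1) x i ^ p * extendSimplex (n+1) x j ^ q
      = (∏ k ∈ (univ.erase i).erase j, Real.Gamma (α k)) *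
        (Real.Gamma (p + 1) * Real.Gamma (q + 1)) /
        Real.Gamma (p + q + 2 + ∑ k ∈ (univ.erase i).erase j, α k) := by
  set β : Fin (n+1) → ℝ := fun k => if k = i then p + 1 else if k = j then q + 1 else α k with hβd
  have hβ : ∀ k, 0 < β k := by
    intro k
    simp only [hβd]
    split_ifs
    · linarith
    · linarith
    · exact hα k
  have hβi : β i = p + 1 := by simp [hβd]
  have hβj : β j = q + 1 := by simp [hβd, hij.symm]
  have hβk : ∀ k ∈ (univ.erase i).erase j, β k = α k := by
    intro k hk
    simp only [Finset.mem_erase, Finset.mem_univ, and_true] at hk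
    simp [hβd, hk.1, hk.2]
  have h := aux_dirichlet_integral n β hβ
  have e1 : (fun x : Fin n → ℝ => ∏ k, extendSimplex (n+1) x k ^ (β k - 1))
      = fun x : Fin n → ℝ => (∏ k ∈ (univ.erase i).erase j,
        extendSimplex (n+1) x k ^ (α k - 1)) *
        extendSimplex (n+1) x i ^ p * extendSimplex (n+1) x j ^ q := by
    funext x
    rw [aux_prod_split i j hij, hβi, hβj, add_sub_cancel_right, add_sub_cancel_right,
      Finset.prod_congr rfl fun k hk => by rw [hβk k hk]]
    ring
  rw [e1, aux_prod_split i j hij, aux_sum_split i j hij, hβi, hβj,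
    Finset.prod_congr rfl fun k hk => by rw [hβk k hk], Finset.sum_congr rfl hβk] at h
  refine ⟨h.1, h.2.trans ?_⟩
  rw [show p + 1 + (q + 1 + ∑ k ∈ (univ.erase i).erase j, α k)
    = p + q + 2 + ∑ k ∈ (univ.erase i).erase j, α k by ring]
  ring

/-- The mixed second derivative identity. -/
theorem aux_mixed (n : ℕ) (α : Fin (n+1) → ℝ) (hα : ∀ k, 0 < α k) (i j : Fin (n+1)) (hij : i ≠ j)
    (p q : ℝ) (hp : 0 < p) (hq : 0 < q) (P S : ℝ)
    (hP : P = ∏ k ∈ (univ.erase i).erase j, Real.Gamma (α k))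
    (hS : S = ∑ k ∈ (univ.erase i).erase j, α k) :
    ∫ x : Fin n → ℝ in simplexChart (n+1), (∏ k ∈ (univ.erase i).erase j,
        extendSimplex (n+1) x k ^ (α k - 1)) *
        (extendSimplex (n+1) x j ^ q * Real.log (extendSimplex (n+1) x j)) *
        (extendSimplex (n+1) x i ^ p * Real.log (extendSimplex (n+1) x i))
      = P * (Real.Gamma (p + 1) * Real.Gamma (q + 1)) / Real.Gamma (p + q + 2 + S) *
        (-trigamma (p + q + 2 + S) + (digamma (p + 1) - digamma (p + q + 2 + S)) *
          (digamma (q + 1) - digamma (p + q + 2 + S))) := by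
  have hS0 : 0 ≤ S := by rw [hS]; exact Finset.sum_nonneg fun k _ => (hα k).le
  have hm : MeasurableSet (simplexChart (n+1)) := aux_meas_set n 1
  have hb : ∀ k, ∀ᵐ x : Fin n → ℝ ∂(volume.restrict (simplexChart (n+1))),
      0 ≤ extendSimplex (n+1) x k ∧ extendSimplex (n+1) x k ≤ 1 := by
    intro k
    filter_upwards [ae_restrict_mem hm] with x hx
    exact aux_extend_mem n x hx k
  set G : (Fin n → ℝ) → ℝ := fun x => ∏ k ∈ (univ.erase i).erase j,
        extendSimplex (n+1) x k ^ (α k - 1) with hG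
  have hGint : Integrable G (volume.restrict (simplexChart (n+1))) := by
    simpa using (aux_M n α hα i j hij 0 0 (by norm_num) (by norm_num)).1
  -- first derivative, in the exponent of `b_j`
  have first : ∀ r : ℝ, 0 < r →
      ∫ x : Fin n → ℝ in simplexChart (n+1), G x *
        (extendSimplex (n+1) x j ^ q * Real.log (extendSimplex (n+1) x j)) *
        extendSimplex (n+1) x i ^ r
      = P * (Real.Gamma (r + 1) * Real.Gamma (q + 1)) / Real.Gamma (r + q + 2 + S) *
        (digamma (q + 1) - digamma (r + q + 2 + S)) := by
    intro r hr
    have hint : Integrable (fun x => G x * extendSimplex (n+1) x i ^ r)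
        (volume.restrict (simplexChart (n+1))) := by
      simpa using (aux_M n α hα i j hij r 0 (by linarith) (by norm_num)).1
    have h1 := (aux_deriv _ _ _ hint (aux_extend_meas n j) (hb j) q hq).2
    have h2 : (fun s : ℝ => ∫ x : Fin n → ℝ in simplexChart (n+1),
        G x * extendSimplex (n+1) x i ^ r * extendSimplex (n+1) x j ^ s)
        =ᶠ[nhds q] fun s => P * (Real.Gamma (r + 1) * Real.Gamma (s + 1)) /
          Real.Gamma (r + s + 2 + S) := by
      filter_upwards [lt_mem_nhds hq] with s hs
      rw [hP, hS]
      exact (aux_M n α hα i j hij r s (by linarith) (by linarith)).2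
    have h3 := h1.congr_of_eventuallyEq h2.symm
    have g1 : HasDerivAt (fun s : ℝ => Real.Gamma (s + 1))
        (Real.Gamma (q + 1) * digamma (q + 1)) q :=
      (aux_hasDerivAt_Gamma (q + 1) (by linarith)).comp_add_const q 1
    have g2 : HasDerivAt (fun s : ℝ => Real.Gamma (r + s + 2 + S))
        (Real.Gamma (r + q + 2 + S) * digamma (r + q + 2 + S)) q := by
      have h0 : HasDerivAt (fun s : ℝ => r + s + 2 + S) 1 q :=
        (((hasDerivAt_id q).const_add r).add_const 2).add_const S
      have h9 := (aux_hasDerivAt_Gamma (r + q + 2 + S) (by linarith)).comp q h0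
      rw [mul_one] at h9
      exact h9
    have hne : Real.Gamma (r + q + 2 + S) ≠ 0 := (Real.Gamma_pos_of_pos (by linarith)).ne'
    have h4 := (((g1.const_mul (Real.Gamma (r + 1))).const_mul P).div g2 hne)
    have h5 := h3.unique h4
    rw [show (fun x : Fin n → ℝ => G x *
        (extendSimplex (n+1) x j ^ q * Real.log (extendSimplex (n+1) x j)) *
        extendSimplex (n+1) x i ^ r) = fun x : Fin n → ℝ => G x * extendSimplex (n+1) x i ^ r *
        (extendSimplex (n+1) x j ^ q * Real.log (extendSimplex (n+1) x j)) from by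
          funext x; ring]
    refine h5.trans ?_
    field_simp
  have hint2 := (aux_deriv _ _ _ hGint (aux_extend_meas n j) (hb j) q hq).1
  have h1 := (aux_deriv _ _ _ hint2 (aux_extend_meas n i) (hb i) p hp).2
  have h2 : (fun s : ℝ => ∫ x : Fin n → ℝ in simplexChart (n+1),
      G x * (extendSimplex (n+1) x j ^ q * Real.log (extendSimplex (n+1) x j)) *
        extendSimplex (n+1) x i ^ s)
      =ᶠ[nhds p] fun s => P * (Real.Gamma (s + 1) * Real.Gamma (q + 1)) /
          Real.Gamma (s + q + 2 + S) * (digamma (q + 1) - digamma (s + q + 2 + S)) := by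
    filter_upwards [lt_mem_nhds hp] with s hs
    exact first s hs
  have h3 := h1.congr_of_eventuallyEq h2.symm
  have g1 : HasDerivAt (fun s : ℝ => Real.Gamma (s + 1))
      (Real.Gamma (p + 1) * digamma (p + 1)) p :=
    (aux_hasDerivAt_Gamma (p + 1) (by linarith)).comp_add_const p 1
  have h0 : HasDerivAt (fun s : ℝ => s + q + 2 + S) 1 p :=
    (((hasDerivAt_id p).add_const q).add_const 2).add_const S
  have g2 : HasDerivAt (fun s : ℝ => Real.Gamma (s + q + 2 + S))
      (Real.Gamma (p + q + 2 + S) * digamma (p + q + 2 + S)) p := by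
    have h9 := (aux_hasDerivAt_Gamma (p + q + 2 + S) (by linarith)).comp p h0
    rw [mul_one] at h9
    exact h9
  have g3 : HasDerivAt (fun s : ℝ => digamma (s + q + 2 + S)) (trigamma (p + q + 2 + S)) p := by
    have h9 := (aux_hasDerivAt_digamma (p + q + 2 + S) (by linarith)).comp p h0
    rw [mul_one] at h9
    exact h9
  have hne : Real.Gamma (p + q + 2 + S) ≠ 0 := (Real.Gamma_pos_of_pos (by linarith)).ne'
  have h4 := (((g1.mul_const (Real.Gamma (q + 1))).const_mul P).div g2 hne).mul
    (g3.const_sub (digamma (q + 1)))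
  refine (h3.unique h4).trans ?_
  simp only [Pi.div_apply]
  field_simp
  ring

/-- For `b ~ Dirichlet(α)` and `i ≠ j`, the expectation of `b_i b_j log b_i log b_j`. -/
theorem dirichlet_expCrossMulLog
    (K : ℕ) (hK : 2 ≤ K) (α : Fin K → ℝ) (hα : ∀ k, 0 < α k)
    (i j : Fin K) (hij : i ≠ j) :
    dirExp α (fun b => b i * b j * Real.log (b i) * Real.log (b j))
      = (α i * α j) / ((∑ k, α k) * ((∑ k, α k) + 1))
        * (-trigamma ((∑ k, α k) + 2)
            + (digamma (α i + 1) - digamma ((∑ k, α k) + 2))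
              * (digamma (α j + 1) - digamma ((∑ k, α k) + 2))) := by
  obtain ⟨n, rfl⟩ : ∃ n, K = n + 1 := ⟨K - 1, by omega⟩
  set P := ∏ k ∈ (univ.erase i).erase j, Real.Gamma (α k) with hP
  set S := ∑ k ∈ (univ.erase i).erase j, α k with hS
  have hmix := aux_mixed n α hα i j hij (α i) (α j) (hα i) (hα j) P S hP hS
  have hm : MeasurableSet (simplexChart (n+1)) := aux_meas_set n 1
  have hS0 : 0 ≤ S := Finset.sum_nonneg fun k _ => (hα k).le
  have hP0 : 0 < P := Finset.prod_pos fun k _ => Real.Gamma_pos_of_pos (hα k)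
  have hi := hα i
  have hj := hα j
  have hsum : ∑ k, α k = α i + α j + S := by rw [aux_sum_split i j hij, hS]; ring
  have hprod : ∏ k, Real.Gamma (α k) = Real.Gamma (α i) * (Real.Gamma (α j) * P) :=
    aux_prod_split i j hij _
  have step : dirExp α (fun b => b i * b j * Real.log (b i) * Real.log (b j))
      = (Real.Gamma (∑ k, α k) / ∏ k, Real.Gamma (α k)) *
      ∫ x : Fin n → ℝ in simplexChart (n+1), (∏ k ∈ (univ.erase i).erase j,
        extendSimplex (n+1) x k ^ (α k - 1)) *
        (extendSimplex (n+1) x j ^ α j * Real.log (extendSimplex (n+1) x j)) *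
        (extendSimplex (n+1) x i ^ α i * Real.log (extendSimplex (n+1) x i)) := by
    refine Eq.trans ?_ (integral_const_mul _ _)
    refine setIntegral_congr_fun hm fun x hx => ?_
    have e : ∀ k, extendSimplex (n+1) x k ^ α k
        = extendSimplex (n+1) x k ^ (α k - 1) * extendSimplex (n+1) x k := by
      intro k
      have := Real.rpow_add_one' (y := α k - 1) (aux_extend_mem n x hx k).1
        (by linarith [hα k])
      rwa [sub_add_cancel] at this
    simp only [dirDensity]
    rw [e i, e j, aux_prod_split i j hij (fun k => extendSimplex (n+1) x k ^ (α k - 1))]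
    ring
  rw [step, hmix, hsum, hprod, show α i + α j + 2 + S = (α i + α j + S) + 2 by ring]
  have hA : 0 < α i + α j + S := by linarith
  have hG : Real.Gamma (α i + α j + S + 2)
      = (α i + α j + S + 1) * ((α i + α j + S) * Real.Gamma (α i + α j + S)) := by
    rw [← Real.Gamma_add_one hA.ne', ← Real.Gamma_add_one (by linarith : α i + α j + S + 1 ≠ 0)]
    congr 1; ring
  rw [hG, Real.Gamma_add_one hi.ne', Real.Gamma_add_one hj.ne', ← mul_assoc]
  congr 1
  have h1 := (Real.Gamma_pos_of_pos hi).ne'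
  have h2 := (Real.Gamma_pos_of_pos hj).ne'
  have h3 := (Real.Gamma_pos_of_pos hA).ne'
  have h4 := hP0.ne'
  have h5 : α i + α j + S + 1 ≠ 0 := by linarith
  field_simp
end

section
/- Let K ≥ 1, let α = (α₁,…,α_K) with each α_k > 0 and α₀ = Σ_{k=1}^K α_k, let b ~ Dirichlet(α), and let h = H(b) = −Σ_{k=1}^K b_k log b_k. Then the second moment of the entropy satisfies E[h²] = (1 / (α₀(α₀+1))) · [ Σ_{i=1}^K α_i(α_i+1) { ψ₁(α_i+2) − ψ₁(α₀+2) + (ψ(α_i+2) − ψ(α₀+2))² } + Σ_{i ≠ j} α_i α_j { −ψ₁(α₀+2) + (ψ(α_i+1) − ψ(α₀+2))(ψ(α_j+1) − ψ(α₀+2)) } ], where ψ is the digamma function, ψ₁ is the trigamma function, and the second sum ranges over all ordered pairs (i, j) with i ≠ j. -/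
open MeasureTheory Finset

/-- Normalised power kernel `x^(a-1)/Γ(a)` on `x > 0`, with values in `ℝ≥0∞`. -/
noncomputable def pker (a x : ℝ) : ENNReal :=
  if 0 < x then ENNReal.ofReal (x ^ (a - 1) / Real.Gamma a) else 0

lemma measurable_pker (a : ℝ) : Measurable (pker a) :=
  Measurable.ite measurableSet_Ioi (by fun_prop) (by fun_prop)

lemma pker_conv {a c : ℝ} (ha : 0 < a) (hc : 0 < c) (s : ℝ) :
    ∫⁻ x, pker a x * pker c (s - x) = pker (a + c) s := by
  by_cases hs : 0 < s
  · have hGa := Real.Gamma_pos_of_pos ha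
    have hGc := Real.Gamma_pos_of_pos hc
    have hGac := Real.Gamma_pos_of_pos (add_pos ha hc)
    have hmeas : Measurable (fun x => pker a x * pker c (s - x)) :=
      (measurable_pker a).mul ((measurable_pker c).comp (by fun_prop))
    rw [← Real.smul_map_volume_mul_left hs.ne', lintegral_smul_measure,
      lintegral_map hmeas (by fun_prop)]
    have key : ∀ u : ℝ, pker a (s * u) * pker c (s - s * u)
        = ENNReal.ofReal (s ^ (a + c - 2) / Real.Gamma (a + c))
          * ProbabilityTheory.betaPDF a c u := by
      intro u
      rw [ProbabilityTheory.betaPDF_eq]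
      by_cases h : 0 < u ∧ u < 1
      · have h1 : 0 < s * u := mul_pos hs h.1
        have h2 : 0 < s - s * u := by nlinarith [h.2]
        rw [if_pos h, pker, pker, if_pos h1, if_pos h2, ← ENNReal.ofReal_mul (by positivity),
          ← ENNReal.ofReal_mul (by positivity)]
        congr 1
        rw [show s - s * u = s * (1 - u) by ring, Real.mul_rpow hs.le h.1.le,
          Real.mul_rpow hs.le (by linarith [h.2]), ProbabilityTheory.beta,
          show a + c - 2 = (a - 1) + (c - 1) by ring, Real.rpow_add hs]
        field_simp
      · rw [if_neg h]
        by_cases h1 : 0 < u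
        · have h2 : ¬ (0 < s - s * u) := by
            have : ¬ u < 1 := fun h' => h ⟨h1, h'⟩
            nlinarith
          rw [pker, pker, if_neg h2]; simp
        · have h2 : ¬ (0 < s * u) := by
            rw [mul_pos_iff_of_pos_left hs]; exact h1
          simp [pker, if_neg h2]
    simp_rw [key]
    have hm : Measurable (ProbabilityTheory.betaPDF a c) :=
      (ProbabilityTheory.measurable_betaPDFReal a c).ennreal_ofReal
    rw [lintegral_const_mul _ hm,
      ProbabilityTheory.lintegral_betaPDF_eq_one ha hc, mul_one, smul_eq_mul,
      ← ENNReal.ofReal_mul (by positivity), pker, if_pos hs]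
    congr 1
    rw [abs_of_pos hs, show a + c - 1 = 1 + (a + c - 2) by ring, Real.rpow_add hs, Real.rpow_one]
    ring
  · have : ∀ x, pker a x * pker c (s - x) = 0 := by
      intro x
      by_cases h : 0 < x
      · have : ¬ (0 < s - x) := by linarith
        rw [pker, pker, if_neg this, mul_zero]
      · simp [pker, if_neg h]
    rw [lintegral_congr this, lintegral_zero, pker, if_neg hs]

lemma pker_dirichlet (n : ℕ) (a : Fin n → ℝ) (ha : ∀ i, 0 < a i) {c : ℝ} (hc : 0 < c) (s : ℝ) :
    ∫⁻ x : Fin n → ℝ, (∏ i, pker (a i) (x i)) * pker c (s - ∑ i, x i)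
      = pker ((∑ i, a i) + c) s := by
  induction n generalizing s with
  | zero => simp [lintegral_unique, volume_pi]
  | succ n ih =>
    have hmp := (volume_preserving_piFinSuccAbove (fun _ : Fin (n + 1) => ℝ) 0).symm
    have hmeas : Measurable (fun x : Fin (n + 1) → ℝ =>
        (∏ i, pker (a i) (x i)) * pker c (s - ∑ i, x i)) := by
      refine Measurable.mul (Finset.measurable_prod _ fun i _ => ?_) ?_
      · exact (measurable_pker _).comp (measurable_pi_apply i)
      · exact (measurable_pker _).comp (by fun_prop)
    rw [← hmp.lintegral_comp hmeas]
    rw [Measure.volume_eq_prod, lintegral_prod _ (by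
      exact (hmeas.comp (MeasurableEquiv.measurable _)).aemeasurable)]
    simp only [MeasurableEquiv.piFinSuccAbove_symm_apply, Fin.insertNthEquiv_apply,
      Fin.insertNth_zero', Fin.prod_univ_succ, Fin.sum_univ_succ, Fin.cons_zero, Fin.cons_succ]
    rw [add_assoc, ← pker_conv (ha 0) (add_pos_of_nonneg_of_pos
      (Finset.sum_nonneg fun i _ => (ha (Fin.succ i)).le) hc) s]
    refine lintegral_congr fun x => ?_
    rw [← ih (fun i => a i.succ) (fun i => ha _) (s - x), ← lintegral_const_mul]
    · refine lintegral_congr fun y => ?_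
      rw [mul_assoc, sub_sub]
    · refine Measurable.mul (Finset.measurable_prod _ fun i _ => ?_) ?_
      · exact (measurable_pker _).comp (measurable_pi_apply i)
      · exact (measurable_pker _).comp (by fun_prop)

/-- Extension to the simplex with `n + 1` coordinates. -/
lemma extendSimplex_castSucc (n : ℕ) (x : Fin n → ℝ) (i : Fin n) :
    extendSimplex (n + 1) x i.castSucc = x i := by
  simp [extendSimplex]

lemma extendSimplex_last (n : ℕ) (x : Fin n → ℝ) :
    extendSimplex (n + 1) x (Fin.last n) = 1 - ∑ j, x j := by
  simp [extendSimplex]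

lemma measurable_extendSimplex (n : ℕ) (k : Fin (n + 1)) :
    Measurable (fun x : Fin n → ℝ => extendSimplex (n + 1) x k) := by
  refine Fin.lastCases ?_ (fun i => ?_) k
  · simp_rw [extendSimplex_last]; fun_prop
  · simp_rw [extendSimplex_castSucc]; fun_prop

/-- Density of the (unnormalised) Dirichlet measure. -/
noncomputable def dden (n : ℕ) (β : Fin (n + 1) → ℝ) (x : Fin n → ℝ) : ENNReal :=
  ∏ k, pker (β k) (extendSimplex (n + 1) x k)

lemma measurable_dden (n : ℕ) (β : Fin (n + 1) → ℝ) : Measurable (dden n β) :=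
  Finset.measurable_prod _ fun k _ => (measurable_pker _).comp (measurable_extendSimplex n k)

lemma dden_lintegral (n : ℕ) (β : Fin (n + 1) → ℝ) (hβ : ∀ k, 0 < β k) :
    ∫⁻ x, dden n β x = ENNReal.ofReal (1 / Real.Gamma (∑ k, β k)) := by
  have := pker_dirichlet n (fun i => β i.castSucc) (fun i => hβ _) (hβ (Fin.last n)) 1
  rw [← Fin.sum_univ_castSucc] at this
  simp only [dden, Fin.prod_univ_castSucc, extendSimplex_castSucc, extendSimplex_last]
  rw [this]
  simp [pker]

lemma dden_of_pos (n : ℕ) (β : Fin (n + 1) → ℝ) (hβ : ∀ k, 0 < β k) (x : Fin n → ℝ)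
    (hx : ∀ k, 0 < extendSimplex (n + 1) x k) :
    dden n β x = ENNReal.ofReal
      (∏ k, extendSimplex (n + 1) x k ^ (β k - 1) / Real.Gamma (β k)) := by
  rw [ENNReal.ofReal_prod_of_nonneg]
  · exact Finset.prod_congr rfl fun k _ => by rw [pker, if_pos (hx k)]
  · intro k _
    have := hx k
    have := Real.Gamma_pos_of_pos (hβ k)
    positivity

lemma dden_of_not_pos (n : ℕ) (β : Fin (n + 1) → ℝ) (x : Fin n → ℝ)
    (hx : ¬ ∀ k, 0 < extendSimplex (n + 1) x k) :
    dden n β x = 0 := by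
  push Not at hx
  obtain ⟨k, hk⟩ := hx
  exact Finset.prod_eq_zero (Finset.mem_univ k) (by rw [pker, if_neg hk.not_gt])

lemma analyticAt_Gamma_real {x : ℝ} (hx : 0 < x) : AnalyticAt ℝ Real.Gamma x := by
  have : AnalyticAt ℂ Complex.Gamma (x : ℂ) := by
    have ho : IsOpen {s : ℂ | 0 < s.re} := Complex.continuous_re.isOpen_preimage _ isOpen_Ioi
    refine DifferentiableOn.analyticAt (s := {s : ℂ | 0 < s.re}) (fun s hs => ?_)
      (ho.mem_nhds (by simpa using hx))
    refine (Complex.differentiableAt_Gamma s fun m h => ?_).differentiableWithinAt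
    simp only [Set.mem_ofPred_eq, h, Complex.neg_re, Complex.natCast_re] at hs
    linarith [(Nat.cast_nonneg m : (0:ℝ) ≤ m)]
  have h2 := this.re_ofReal
  simpa [Complex.Gamma_ofReal] using h2

lemma hasDerivAt_logGamma {x : ℝ} (hx : 0 < x) :
    HasDerivAt (fun y => Real.log (Real.Gamma y)) (digamma x) x := by
  have := (analyticAt_Gamma_real hx).differentiableAt.log (Real.Gamma_pos_of_pos hx).ne'
  exact this.hasDerivAt

lemma hasDerivAt_digamma {x : ℝ} (hx : 0 < x) :
    HasDerivAt digamma (trigamma x) x := by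
  have h1 : AnalyticAt ℝ (fun y => Real.log (Real.Gamma y)) x :=
    (analyticAt_Gamma_real hx).log (Real.Gamma_pos_of_pos hx)
  exact (h1.deriv.differentiableAt).hasDerivAt

/-- The (unnormalised) Dirichlet measure on the chart. -/
noncomputable def dmeas (n : ℕ) (β : Fin (n + 1) → ℝ) : Measure (Fin n → ℝ) :=
  volume.withDensity (dden n β)

/-- Linear combination of the logarithms of the coordinates. -/
noncomputable def logComb (n : ℕ) (c : Fin (n + 1) → ℝ) (x : Fin n → ℝ) : ℝ :=
  ∑ k, c k * Real.log (extendSimplex (n + 1) x k)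

lemma measurable_logComb (n : ℕ) (c : Fin (n + 1) → ℝ) : Measurable (logComb n c) := by
  unfold logComb
  exact Finset.measurable_sum _ fun k _ =>
    ((measurable_extendSimplex n k).log).const_mul _

lemma exp_mul_dden (n : ℕ) (β c : Fin (n + 1) → ℝ) (hβ : ∀ k, 0 < β k) (t : ℝ)
    (ht : ∀ k, 0 < β k + t * c k) (x : Fin n → ℝ) :
    dden n β x * ENNReal.ofReal (Real.exp (t * logComb n c x))
      = ENNReal.ofReal (∏ k, Real.Gamma (β k + t * c k) / Real.Gamma (β k))
        * dden n (fun k => β k + t * c k) x := by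
  by_cases hx : ∀ k, 0 < extendSimplex (n + 1) x k
  · have hG : ∀ k, 0 < Real.Gamma (β k) := fun k => Real.Gamma_pos_of_pos (hβ k)
    have hG' : ∀ k, 0 < Real.Gamma (β k + t * c k) := fun k => Real.Gamma_pos_of_pos (ht k)
    rw [dden_of_pos n β hβ x hx, dden_of_pos n _ ht x hx, ← ENNReal.ofReal_mul, ← ENNReal.ofReal_mul]
    · congr 1
      rw [logComb, Finset.mul_sum, Real.exp_sum, ← Finset.prod_mul_distrib,
        ← Finset.prod_mul_distrib]
      refine Finset.prod_congr rfl fun k _ => ?_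
      have h1 : Real.exp (t * (c k * Real.log (extendSimplex (n + 1) x k)))
          = extendSimplex (n + 1) x k ^ (t * c k) := by
        rw [Real.rpow_def_of_pos (hx k)]; congr 1; ring
      rw [h1, show β k + t * c k - 1 = (β k - 1) + t * c k by ring, Real.rpow_add (hx k)]
      have := hG k
      have := hG' k
      field_simp
    · exact Finset.prod_nonneg fun k _ => (div_pos (hG' k) (hG k)).le
    · exact Finset.prod_nonneg fun k _ =>
        (div_pos (Real.rpow_pos_of_pos (hx k) _) (hG k)).le
  · rw [dden_of_not_pos n _ x hx, dden_of_not_pos n _ x hx]; simp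

/-- The value of the moment generating function. -/
noncomputable def mval (n : ℕ) (β c : Fin (n + 1) → ℝ) (t : ℝ) : ℝ :=
  (∏ k, Real.Gamma (β k + t * c k) / Real.Gamma (β k))
    * (1 / Real.Gamma (∑ k, (β k + t * c k)))

lemma sum_pos_fin (n : ℕ) (β : Fin (n + 1) → ℝ) (hβ : ∀ k, 0 < β k) : 0 < ∑ k, β k :=
  Finset.sum_pos (fun k _ => hβ k) Finset.univ_nonempty

lemma mval_pos (n : ℕ) (β c : Fin (n + 1) → ℝ) (hβ : ∀ k, 0 < β k) (t : ℝ)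
    (ht : ∀ k, 0 < β k + t * c k) : 0 < mval n β c t := by
  refine mul_pos (Finset.prod_pos fun k _ => div_pos (Real.Gamma_pos_of_pos (ht k))
    (Real.Gamma_pos_of_pos (hβ k))) (one_div_pos.2 (Real.Gamma_pos_of_pos ?_))
  exact sum_pos_fin n _ ht

lemma lintegral_exp (n : ℕ) (β c : Fin (n + 1) → ℝ) (hβ : ∀ k, 0 < β k) (t : ℝ)
    (ht : ∀ k, 0 < β k + t * c k) :
    ∫⁻ x, ENNReal.ofReal (Real.exp (t * logComb n c x)) ∂(dmeas n β)
      = ENNReal.ofReal (mval n β c t) := by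
  have hm : Measurable fun x => ENNReal.ofReal (Real.exp (t * logComb n c x)) :=
    (((measurable_logComb n c).const_mul t).exp).ennreal_ofReal
  rw [dmeas, lintegral_withDensity_eq_lintegral_mul _ (measurable_dden n β) hm]
  simp only [Pi.mul_apply, exp_mul_dden n β c hβ t ht]
  rw [lintegral_const_mul _ (measurable_dden n _), dden_lintegral n _ ht,
    ← ENNReal.ofReal_mul, mval]
  exact Finset.prod_nonneg fun k _ => (div_pos (Real.Gamma_pos_of_pos (ht k))
    (Real.Gamma_pos_of_pos (hβ k))).le

lemma integrable_exp (n : ℕ) (β c : Fin (n + 1) → ℝ) (hβ : ∀ k, 0 < β k) (t : ℝ)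
    (ht : ∀ k, 0 < β k + t * c k) :
    Integrable (fun x => Real.exp (t * logComb n c x)) (dmeas n β) := by
  refine ⟨(((measurable_logComb n c).const_mul t).exp).aestronglyMeasurable, ?_⟩
  rw [hasFiniteIntegral_iff_ofReal (Filter.Eventually.of_forall fun x => (Real.exp_pos _).le),
    lintegral_exp n β c hβ t ht]
  exact ENNReal.ofReal_lt_top

lemma mgf_logComb (n : ℕ) (β c : Fin (n + 1) → ℝ) (hβ : ∀ k, 0 < β k) (t : ℝ)
    (ht : ∀ k, 0 < β k + t * c k) :
    ProbabilityTheory.mgf (logComb n c) (dmeas n β) t = mval n β c t := by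
  rw [ProbabilityTheory.mgf, integral_eq_lintegral_of_nonneg_ae
    (Filter.Eventually.of_forall fun x => (Real.exp_pos _).le)
    (((measurable_logComb n c).const_mul t).exp).aestronglyMeasurable,
    lintegral_exp n β c hβ t ht, ENNReal.toReal_ofReal (mval_pos n β c hβ t ht).le]

lemma eventually_pos (n : ℕ) (β c : Fin (n + 1) → ℝ) (t₀ : ℝ) (h0 : ∀ k, 0 < β k + t₀ * c k) :
    ∀ᶠ t in nhds t₀, ∀ k, 0 < β k + t * c k := by
  rw [Filter.eventually_all]
  intro k
  have : ContinuousAt (fun t : ℝ => β k + t * c k) t₀ := by fun_prop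
  exact this.eventually (lt_mem_nhds (h0 k))

lemma zero_mem_interior (n : ℕ) (β c : Fin (n + 1) → ℝ) (hβ : ∀ k, 0 < β k) :
    0 ∈ interior (ProbabilityTheory.integrableExpSet (logComb n c) (dmeas n β)) := by
  rw [mem_interior_iff_mem_nhds]
  filter_upwards [eventually_pos n β c 0 (by simpa using hβ)] with t ht
  exact integrable_exp n β c hβ t ht

/-- derivative of the logarithm of `mval` -/
noncomputable def lder (n : ℕ) (β c : Fin (n + 1) → ℝ) (t : ℝ) : ℝ :=
  (∑ k, digamma (β k + t * c k) * c k)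
    - digamma (∑ k, (β k + t * c k)) * (∑ k, c k)

lemma hasDerivAt_mval (n : ℕ) (β c : Fin (n + 1) → ℝ) (hβ : ∀ k, 0 < β k) (t : ℝ)
    (ht : ∀ k, 0 < β k + t * c k) :
    HasDerivAt (mval n β c) (mval n β c t * lder n β c t) t := by
  have hS := sum_pos_fin n _ ht
  have hlin : ∀ k, HasDerivAt (fun t : ℝ => β k + t * c k) (c k) t := fun k => by
    simpa using ((hasDerivAt_id t).mul_const (c k)).const_add (β k)
  have hlinS : HasDerivAt (fun t : ℝ => ∑ k, (β k + t * c k)) (∑ k, c k) t :=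
    HasDerivAt.fun_sum fun k _ => hlin k
  have hL : HasDerivAt (fun t => (∑ k, (Real.log (Real.Gamma (β k + t * c k))
      - Real.log (Real.Gamma (β k)))) - Real.log (Real.Gamma (∑ k, (β k + t * c k))))
      (lder n β c t) t := by
    refine HasDerivAt.sub (HasDerivAt.fun_sum fun k _ => ?_) ?_
    · exact ((hasDerivAt_logGamma (ht k)).comp t (hlin k)).sub_const _
    · exact (hasDerivAt_logGamma hS).comp t hlinS
  have hexp : ∀ s, (∀ k, 0 < β k + s * c k) → mval n β c s =
      Real.exp ((∑ k, (Real.log (Real.Gamma (β k + s * c k))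
      - Real.log (Real.Gamma (β k)))) - Real.log (Real.Gamma (∑ k, (β k + s * c k)))) := by
    intro s hs
    rw [Real.exp_sub, Real.exp_log (Real.Gamma_pos_of_pos (sum_pos_fin n _ hs)), Real.exp_sum,
      mval, mul_one_div]
    congr 1
    refine Finset.prod_congr rfl fun k _ => ?_
    rw [Real.exp_sub, Real.exp_log (Real.Gamma_pos_of_pos (hs k)),
      Real.exp_log (Real.Gamma_pos_of_pos (hβ k))]
  have h2 := hL.exp
  rw [← hexp t ht] at h2
  refine h2.congr_of_eventuallyEq ?_
  filter_upwards [eventually_pos n β c t ht] with s hs using hexp s hs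

lemma hasDerivAt_lder (n : ℕ) (β c : Fin (n + 1) → ℝ) (hβ : ∀ k, 0 < β k) :
    HasDerivAt (lder n β c) ((∑ k, trigamma (β k) * c k * c k)
      - trigamma (∑ k, β k) * (∑ k, c k) * (∑ k, c k)) 0 := by
  have hlin : ∀ k, HasDerivAt (fun t : ℝ => β k + t * c k) (c k) 0 := fun k => by
    simpa using ((hasDerivAt_id (0:ℝ)).mul_const (c k)).const_add (β k)
  have hlinS : HasDerivAt (fun t : ℝ => ∑ k, (β k + t * c k)) (∑ k, c k) 0 :=
    HasDerivAt.fun_sum fun k _ => hlin k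
  refine HasDerivAt.sub (HasDerivAt.fun_sum fun k _ => ?_) ?_
  · refine HasDerivAt.mul_const ?_ _
    have h : HasDerivAt digamma (trigamma (β k)) (β k + 0 * c k) := by
      simpa using hasDerivAt_digamma (hβ k)
    exact h.comp 0 (hlin k)
  · refine HasDerivAt.mul_const ?_ _
    have h : HasDerivAt digamma (trigamma (∑ k, β k)) (∑ k, (β k + 0 * c k)) := by
      simpa using hasDerivAt_digamma (sum_pos_fin n β hβ)
    exact h.comp 0 hlinS

/-- Second moments of linear combinations of logarithms. -/
lemma second_moment (n : ℕ) (β c : Fin (n + 1) → ℝ) (hβ : ∀ k, 0 < β k) :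
    ∫ x, logComb n c x ^ 2 ∂(dmeas n β) = (1 / Real.Gamma (∑ k, β k)) *
      ((∑ k, trigamma (β k) * c k * c k) - trigamma (∑ k, β k) * (∑ k, c k) * (∑ k, c k)
      + ((∑ k, digamma (β k) * c k) - digamma (∑ k, β k) * (∑ k, c k)) ^ 2) := by
  have h0 : ∀ k, 0 < β k + 0 * c k := by simpa using hβ
  have key := ProbabilityTheory.iteratedDeriv_mgf_zero (zero_mem_interior n β c hβ) 2
  simp only [Pi.pow_apply] at key
  rw [← key, iteratedDeriv_succ, iteratedDeriv_one]
  have e1 : ProbabilityTheory.mgf (logComb n c) (dmeas n β) =ᶠ[nhds 0] mval n β c := by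
    filter_upwards [eventually_pos n β c 0 h0] with t ht using mgf_logComb n β c hβ t ht
  have e2 : deriv (mval n β c) =ᶠ[nhds 0] fun t => mval n β c t * lder n β c t := by
    filter_upwards [eventually_pos n β c 0 h0] with t ht using
      (hasDerivAt_mval n β c hβ t ht).deriv
  rw [(e1.deriv.trans e2).deriv_eq,
    ((hasDerivAt_mval n β c hβ 0 h0).fun_mul (hasDerivAt_lder n β c hβ)).deriv]
  have hm : mval n β c 0 = 1 / Real.Gamma (∑ k, β k) := by
    have : ∀ k, Real.Gamma (β k) ≠ 0 := fun k => (Real.Gamma_pos_of_pos (hβ k)).ne'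
    simp [mval, this]
  have hl : lder n β c 0 = (∑ k, digamma (β k) * c k) - digamma (∑ k, β k) * (∑ k, c k) := by
    simp [lder]
  rw [hm, hl]
  ring

lemma logComb_add_single (n : ℕ) (i j : Fin (n + 1)) (s : ℝ) (x : Fin n → ℝ) :
    logComb n (Pi.single i 1 + Pi.single j s) x
      = Real.log (extendSimplex (n + 1) x i) + s * Real.log (extendSimplex (n + 1) x j) := by
  simp [logComb, add_mul, Finset.sum_add_distrib, Pi.single_apply]

lemma polar_fun (n : ℕ) (i j : Fin (n + 1)) :
    (fun x : Fin n → ℝ => Real.log (extendSimplex (n + 1) x i)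
      * Real.log (extendSimplex (n + 1) x j))
    = fun x => (logComb n (Pi.single i 1 + Pi.single j 1) x ^ 2
      - logComb n (Pi.single i 1 + Pi.single j (-1)) x ^ 2) / 4 := by
  funext x
  rw [logComb_add_single, logComb_add_single]; ring

lemma integrable_loglog (n : ℕ) (β : Fin (n + 1) → ℝ) (hβ : ∀ k, 0 < β k) (i j : Fin (n + 1)) :
    Integrable (fun x : Fin n → ℝ => Real.log (extendSimplex (n + 1) x i)
      * Real.log (extendSimplex (n + 1) x j)) (dmeas n β) := by
  rw [polar_fun]
  have h := fun c => ProbabilityTheory.integrable_pow_of_mem_interior_integrableExpSet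
    (zero_mem_interior n β c hβ) 2
  exact ((h _).sub (h _)).div_const 4

lemma integral_loglog (n : ℕ) (β : Fin (n + 1) → ℝ) (hβ : ∀ k, 0 < β k) (i j : Fin (n + 1)) :
    ∫ x : Fin n → ℝ, Real.log (extendSimplex (n + 1) x i)
      * Real.log (extendSimplex (n + 1) x j) ∂(dmeas n β)
    = (1 / Real.Gamma (∑ k, β k)) * ((if i = j then trigamma (β i) else 0)
        - trigamma (∑ k, β k) + (digamma (β i) - digamma (∑ k, β k))
          * (digamma (β j) - digamma (∑ k, β k))) := by
  rw [polar_fun]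
  have h := fun c => ProbabilityTheory.integrable_pow_of_mem_interior_integrableExpSet
    (zero_mem_interior n β c hβ) 2
  rw [integral_div, integral_sub (h _) (h _), second_moment n β _ hβ, second_moment n β _ hβ]
  have s1 : ∀ s : ℝ, ∑ k, (Pi.single i 1 + Pi.single j s : Fin (n + 1) → ℝ) k = 1 + s := by
    intro s; simp [Finset.sum_add_distrib]
  have s2 : ∀ s : ℝ, ∑ k, digamma (β k) * (Pi.single i 1 + Pi.single j s : Fin (n + 1) → ℝ) k
      = digamma (β i) + digamma (β j) * s := by
    intro s; simp [Finset.sum_add_distrib, mul_add, Pi.single_apply]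
  have s3 : ∀ s : ℝ, ∑ k, trigamma (β k) * (Pi.single i 1 + Pi.single j s : Fin (n + 1) → ℝ) k
        * (Pi.single i 1 + Pi.single j s : Fin (n + 1) → ℝ) k
      = trigamma (β i) + trigamma (β j) * s * s
        + 2 * (if i = j then trigamma (β i) else 0) * s := by
    intro s
    by_cases hij : i = j
    · subst hij
      simp [Finset.sum_add_distrib, mul_add, Pi.single_apply]
      ring
    · have hji : ¬ j = i := fun h => hij h.symm
      simp [Finset.sum_add_distrib, mul_add, add_mul, Pi.single_apply, hij, hji]
  rw [s1, s1, s2, s2, s3, s3]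
  ring

lemma ae_ne_zero (n : ℕ) (k : Fin (n + 1)) :
    ∀ᵐ x : Fin n → ℝ, extendSimplex (n + 1) x k ≠ 0 := by
  have gen : ∀ (f : (Fin n → ℝ) →ᵃ[ℝ] ℝ), (∃ x, f x ≠ 0) → ∀ᵐ x : Fin n → ℝ, f x ≠ 0 := by
    intro f ⟨x, hx⟩
    let S : AffineSubspace ℝ (Fin n → ℝ) := (AffineSubspace.mk' (0 : ℝ) ⊥).comap f
    have hS : ∀ y, y ∈ S ↔ f y = 0 := by
      intro y
      simp [S]
    have hne : S ≠ ⊤ := by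
      intro h
      exact hx ((hS x).1 (h ▸ AffineSubspace.mem_top ℝ _ x))
    have := Measure.addHaar_affineSubspace (volume : Measure (Fin n → ℝ)) S hne
    rw [ae_iff]
    convert this using 2
    ext y
    simp [hS]
  refine Fin.lastCases ?_ (fun i => ?_) k
  · simp_rw [extendSimplex_last]
    let f : (Fin n → ℝ) →ᵃ[ℝ] ℝ := AffineMap.const ℝ _ 1
      - (∑ j, (LinearMap.proj j : (Fin n → ℝ) →ₗ[ℝ] ℝ)).toAffineMap
    have hf : ∀ x, f x = 1 - ∑ j, x j := by intro x; simp [f]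
    simpa only [hf] using gen f ⟨0, by simp [hf]⟩
  · simp_rw [extendSimplex_castSucc]
    let f : (Fin n → ℝ) →ᵃ[ℝ] ℝ := (LinearMap.proj i : (Fin n → ℝ) →ₗ[ℝ] ℝ).toAffineMap
    have hf : ∀ x, f x = x i := by intro x; simp [f]
    simpa only [hf] using gen f ⟨fun _ => 1, by simp [hf]⟩

lemma mem_chart_iff (n : ℕ) (x : Fin n → ℝ) :
    x ∈ simplexChart (n + 1) ↔ ∀ k, 0 ≤ extendSimplex (n + 1) x k := by
  rw [Fin.forall_fin_succ']
  simp only [extendSimplex_castSucc, extendSimplex_last, simplexChart]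
  simp

lemma measurableSet_chart (n : ℕ) : MeasurableSet (simplexChart (n + 1) : Set (Fin n → ℝ)) := by
  have : (simplexChart (n + 1) : Set (Fin n → ℝ))
      = ⋂ k, {x | 0 ≤ extendSimplex (n + 1) x k} := by
    ext x
    rw [mem_chart_iff]; simp
  rw [this]
  exact MeasurableSet.iInter fun k => measurableSet_le measurable_const
    (measurable_extendSimplex n k)

lemma prod_single {m : ℕ} (F : Fin m → ℝ → ℝ) (γ : Fin m → ℝ) (i : Fin m) (c : ℝ)
    (h : F i (γ i + 1) = c * F i (γ i)) :
    ∏ k, F k ((γ + Pi.single i 1 : Fin m → ℝ) k) = c * ∏ k, F k (γ k) := by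
  rw [← Finset.mul_prod_erase _ _ (Finset.mem_univ i),
    ← Finset.mul_prod_erase Finset.univ (fun k => F k (γ k)) (Finset.mem_univ i), ← mul_assoc, ← h]
  congr 1
  · simp
  · refine Finset.prod_congr rfl fun k hk => ?_
    simp [Finset.ne_of_mem_erase hk]

/-- The shifted parameter. -/
noncomputable def shift {m : ℕ} (α : Fin m → ℝ) (i j : Fin m) : Fin m → ℝ :=
  α + Pi.single i 1 + Pi.single j 1

lemma single_nonneg' {m : ℕ} (i k : Fin m) : (0 : ℝ) ≤ (Pi.single i 1 : Fin m → ℝ) k := by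
  rw [Pi.single_apply]; split_ifs <;> norm_num

lemma shift_pos {m : ℕ} (α : Fin m → ℝ) (hα : ∀ k, 0 < α k) (i j : Fin m) (k : Fin m) :
    0 < shift α i j k := by
  have := single_nonneg' i k
  have := single_nonneg' j k
  have := hα k
  simp only [shift, Pi.add_apply]; linarith

/-- The coefficient `α_i (α_j + δ_ij)`. -/
noncomputable def coef {m : ℕ} (α : Fin m → ℝ) (i j : Fin m) : ℝ :=
  α i * (α j + (Pi.single i 1 : Fin m → ℝ) j)

lemma coef_pos {m : ℕ} (α : Fin m → ℝ) (hα : ∀ k, 0 < α k) (i j : Fin m) :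
    0 < coef α i j := by
  have := single_nonneg' i j
  have := hα i
  have := hα j
  unfold coef; positivity

lemma prod_Gamma_shift {m : ℕ} (α : Fin m → ℝ) (hα : ∀ k, 0 < α k) (i j : Fin m) :
    ∏ k, Real.Gamma (shift α i j k) = coef α i j * ∏ k, Real.Gamma (α k) := by
  have hp : 0 < (α + Pi.single i 1 : Fin m → ℝ) j := by
    have := single_nonneg' i j
    have := hα j
    simp only [Pi.add_apply]; linarith
  rw [shift, prod_single (fun _ => Real.Gamma) _ j _ (Real.Gamma_add_one hp.ne'),
    prod_single (fun _ => Real.Gamma) _ i _ (Real.Gamma_add_one (hα i).ne'), coef, Pi.add_apply]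
  ring

lemma prod_rpow_shift {m : ℕ} (α b : Fin m → ℝ) (hb : ∀ k, 0 < b k) (i j : Fin m) :
    ∏ k, b k ^ (shift α i j k - 1) = b i * b j * ∏ k, b k ^ (α k - 1) := by
  have h : ∀ i (y : ℝ), b i ^ (y + 1 - 1) = b i * b i ^ (y - 1) := by
    intro i y
    rw [show y + 1 - 1 = 1 + (y - 1) by ring, Real.rpow_add (hb i), Real.rpow_one]
  rw [shift, prod_single (fun k y => b k ^ (y - 1)) _ j _ (h j _),
    prod_single (fun k y => b k ^ (y - 1)) _ i _ (h i _)]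
  ring

lemma sum_shift {m : ℕ} (α : Fin m → ℝ) (i j : Fin m) :
    ∑ k, shift α i j k = (∑ k, α k) + 2 := by
  simp only [shift, Pi.add_apply, Finset.sum_add_distrib, Finset.sum_pi_single', Finset.mem_univ, if_true]
  ring

lemma pointwise (n : ℕ) (α : Fin (n + 1) → ℝ) (hα : ∀ k, 0 < α k) (x : Fin n → ℝ)
    (hx : ∀ k, 0 < extendSimplex (n + 1) x k) :
    (-∑ k, extendSimplex (n + 1) x k * Real.log (extendSimplex (n + 1) x k)) ^ 2
        * dirDensity α (extendSimplex (n + 1) x)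
      = ∑ i, ∑ j, coef α i j * Real.Gamma (∑ k, α k) * ((dden n (shift α i j) x).toReal *
        (Real.log (extendSimplex (n + 1) x i) * Real.log (extendSimplex (n + 1) x j))) := by
  set b := extendSimplex (n + 1) x
  rw [neg_sq, sq, Finset.sum_mul_sum, Finset.sum_mul]
  refine Finset.sum_congr rfl fun i _ => ?_
  rw [Finset.sum_mul]
  refine Finset.sum_congr rfl fun j _ => ?_
  have hG : 0 < ∏ k, Real.Gamma (α k) := Finset.prod_pos fun k _ => Real.Gamma_pos_of_pos (hα k)
  have hc := coef_pos α hα i j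
  rw [dden_of_pos n _ (shift_pos α hα i j) x hx, ENNReal.toReal_ofReal
    (Finset.prod_nonneg fun k _ => (div_pos (Real.rpow_pos_of_pos (hx k) _)
      (Real.Gamma_pos_of_pos (shift_pos α hα i j k))).le), Finset.prod_div_distrib,
    prod_Gamma_shift α hα, prod_rpow_shift α b hx, dirDensity]
  field_simp

lemma dmeas_integral (n : ℕ) (β : Fin (n + 1) → ℝ) (f : (Fin n → ℝ) → ℝ) :
    ∫ x, f x ∂(dmeas n β) = ∫ x, (dden n β x).toReal * f x := by
  rw [dmeas, integral_withDensity_eq_integral_toReal_smul (measurable_dden n β)]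
  · simp
  · refine Filter.Eventually.of_forall fun x => ?_
    refine ENNReal.prod_lt_top fun k _ => ?_
    unfold pker
    split_ifs <;> simp

lemma dmeas_integrable (n : ℕ) (β : Fin (n + 1) → ℝ) (f : (Fin n → ℝ) → ℝ)
    (hf : Integrable f (dmeas n β)) : Integrable (fun x => (dden n β x).toReal * f x) := by
  rw [dmeas, integrable_withDensity_iff_integrable_smul' (measurable_dden n β)] at hf
  · simpa using hf
  · refine Filter.Eventually.of_forall fun x => ?_
    refine ENNReal.prod_lt_top fun k _ => ?_
    unfold pker
    split_ifs <;> simp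

lemma main_expand (n : ℕ) (α : Fin (n + 1) → ℝ) (hα : ∀ k, 0 < α k) :
    dirExp α (fun b => (-∑ k, b k * Real.log (b k)) ^ 2)
      = ∑ i, ∑ j, coef α i j * Real.Gamma (∑ k, α k)
        * ∫ x : Fin n → ℝ, Real.log (extendSimplex (n + 1) x i)
            * Real.log (extendSimplex (n + 1) x j) ∂(dmeas n (shift α i j)) := by
  have hint : ∀ i j, Integrable (fun x : Fin n → ℝ => coef α i j * Real.Gamma (∑ k, α k)
      * ((dden n (shift α i j) x).toReal *
        (Real.log (extendSimplex (n + 1) x i) * Real.log (extendSimplex (n + 1) x j)))) :=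
    fun i j => (dmeas_integrable n _ _
      (integrable_loglog n _ (shift_pos α hα i j) i j)).const_mul _
  simp_rw [dmeas_integral, ← integral_const_mul]
  have e1 : ∀ i, ∑ j, ∫ x : Fin n → ℝ, coef α i j * Real.Gamma (∑ k, α k)
      * ((dden n (shift α i j) x).toReal *
        (Real.log (extendSimplex (n + 1) x i) * Real.log (extendSimplex (n + 1) x j)))
      = ∫ x : Fin n → ℝ, ∑ j, coef α i j * Real.Gamma (∑ k, α k)
      * ((dden n (shift α i j) x).toReal *
        (Real.log (extendSimplex (n + 1) x i) * Real.log (extendSimplex (n + 1) x j))) :=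
    fun i => (integral_finsetSum _ fun j _ => hint i j).symm
  simp_rw [e1]
  rw [← integral_finsetSum _ fun i _ => integrable_finsetSum _ fun j _ => hint i j, dirExp]
  change ∫ x : Fin n → ℝ in simplexChart (n + 1), _ = _
  refine (integral_indicator (X := Fin n → ℝ) (measurableSet_chart n)).symm.trans ?_
  refine integral_congr_ae ?_
  have hne : ∀ᵐ x : Fin n → ℝ, ∀ k, extendSimplex (n + 1) x k ≠ 0 :=
    ae_all_iff.2 fun k => ae_ne_zero n k
  filter_upwards [hne] with x hx
  by_cases hpos : ∀ k, 0 < extendSimplex (n + 1) x k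
  · rw [Set.indicator_of_mem ((mem_chart_iff n x).2 fun k => (hpos k).le)]
    exact pointwise n α hα x hpos
  · rw [Set.indicator_of_notMem]
    · simp [dden_of_not_pos n _ x hpos]
    · intro h
      rw [mem_chart_iff] at h
      exact hpos fun k => lt_of_le_of_ne (h k) (hx k).symm

/-- Second moment of the Shannon entropy of `b ~ Dirichlet(α)`. -/
theorem dirichlet_entropy_second_moment
    (K : ℕ) (hK : 1 ≤ K) (α : Fin K → ℝ) (hα : ∀ k, 0 < α k) :
    dirExp α (fun b => (-∑ k, b k * Real.log (b k)) ^ 2)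
      = (1 / ((∑ k, α k) * ((∑ k, α k) + 1)))
        * ((∑ i, α i * (α i + 1)
              * (trigamma (α i + 2) - trigamma ((∑ k, α k) + 2)
                  + (digamma (α i + 2) - digamma ((∑ k, α k) + 2)) ^ 2))
           + ∑ i, ∑ j ∈ Finset.univ.erase i, α i * α j
              * (-trigamma ((∑ k, α k) + 2)
                  + (digamma (α i + 1) - digamma ((∑ k, α k) + 2))
                    * (digamma (α j + 1) - digamma ((∑ k, α k) + 2)))) := by
  obtain ⟨n, rfl⟩ : ∃ n, K = n + 1 := ⟨K - 1, by omega⟩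
  rw [main_expand n α hα]
  have hA := sum_pos_fin n α hα
  have hG2 : Real.Gamma ((∑ k, α k) + 2)
      = ((∑ k, α k) + 1) * ((∑ k, α k) * Real.Gamma (∑ k, α k)) := by
    rw [show (∑ k, α k) + 2 = ((∑ k, α k) + 1) + 1 by ring, Real.Gamma_add_one (by linarith),
      Real.Gamma_add_one hA.ne']
  have hG := Real.Gamma_pos_of_pos hA
  rw [← Finset.sum_add_distrib, Finset.mul_sum]
  refine Finset.sum_congr rfl fun i _ => ?_
  rw [← Finset.add_sum_erase _ _ (Finset.mem_univ i), mul_add, Finset.mul_sum]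
  congr 1
  · rw [integral_loglog n _ (shift_pos α hα i i), sum_shift, hG2]
    have hs : shift α i i i = α i + 2 := by simp [shift]; ring
    rw [hs, if_pos rfl, coef, Pi.single_eq_same]
    field_simp
  · refine Finset.sum_congr rfl fun j hj => ?_
    have hji : j ≠ i := Finset.ne_of_mem_erase hj
    rw [integral_loglog n _ (shift_pos α hα i j), sum_shift, hG2]
    have hs : shift α i j i = α i + 1 := by simp [shift, hji.symm]
    have hs' : shift α i j j = α j + 1 := by simp [shift, hji]
    rw [hs, hs', if_neg hji.symm, coef, Pi.single_eq_of_ne hji]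
    field_simp
    ring
end

section
/- Let K ≥ 1, let α = (α₁,…,α_K) with each α_k > 0 and α₀ = Σ_{k=1}^K α_k, let b ~ Dirichlet(α), and let h = H(b) = −Σ_{k=1}^K b_k log b_k. Then the variance of the entropy satisfies Var[h] = (1 / (α₀(α₀+1))) · [ Σ_{i=1}^K α_i(α_i+1) { ψ₁(α_i+2) − ψ₁(α₀+2) + (ψ(α_i+2) − ψ(α₀+2))² } + Σ_{i ≠ j} α_i α_j { −ψ₁(α₀+2) + (ψ(α_i+1) − ψ(α₀+2))(ψ(α_j+1) − ψ(α₀+2)) } ] − ( ψ(α₀ + 1) − Σ_{i=1}^K (α_i / α₀) ψ(α_i + 1) )², where ψ is the digamma function, ψ₁ is the trigamma function, and the sum Σ_{i ≠ j} ranges over all ordered pairs (i, j) with i ≠ j. -/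
open MeasureTheory Finset

namespace DirEnt

open scoped ENNReal Topology

lemma analyticAt_Gamma {x : ℝ} (hx : 0 < x) : AnalyticAt ℝ Real.Gamma x := by
  have h : AnalyticAt ℂ Complex.Gamma (x : ℂ) := by
    rw [Complex.analyticAt_iff_eventually_differentiableAt]
    have : ∀ᶠ z : ℂ in 𝓝 (x : ℂ), 0 < z.re :=
      (Complex.continuous_re.isOpen_preimage _ isOpen_Ioi).mem_nhds (by simpa using hx)
    filter_upwards [this] with z hz
    refine Complex.differentiableAt_Gamma z fun m hm => ?_
    rw [hm] at hz
    simp at hz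
    have : (0 : ℝ) ≤ m := Nat.cast_nonneg m
    linarith
  have h2 := h.re_ofReal
  simpa [Complex.Gamma_ofReal] using h2

lemma analyticAt_logGamma {x : ℝ} (hx : 0 < x) :
    AnalyticAt ℝ (fun y => Real.log (Real.Gamma y)) x :=
  (analyticAt_Gamma hx).log (Real.Gamma_pos_of_pos hx)

lemma hasDerivAt_logGamma {x : ℝ} (hx : 0 < x) :
    HasDerivAt (fun y => Real.log (Real.Gamma y)) (digamma x) x :=
  (analyticAt_logGamma hx).differentiableAt.hasDerivAt

lemma hasDerivAt_digamma {x : ℝ} (hx : 0 < x) :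
    HasDerivAt digamma (trigamma x) x :=
  (analyticAt_logGamma hx).deriv.differentiableAt.hasDerivAt

/-- power weight -/
noncomputable def g (a x : ℝ) : ℝ≥0∞ := if 0 < x then ENNReal.ofReal (x ^ (a - 1)) else 0

lemma g_of_nonpos {a x : ℝ} (hx : x ≤ 0) : g a x = 0 := by simp [g, hx.not_gt]

lemma g_of_pos {a x : ℝ} (hx : 0 < x) : g a x = ENNReal.ofReal (x ^ (a - 1)) := by simp [g, hx]

lemma measurable_g (a : ℝ) : Measurable (g a) :=
  Measurable.ite measurableSet_Ioi (by fun_prop) (by fun_prop)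

lemma conv_g {a c : ℝ} (ha : 0 < a) (hc : 0 < c) (r : ℝ) :
    ∫⁻ u, g a u * g c (r - u) = ENNReal.ofReal (ProbabilityTheory.beta a c) * g (a + c) r := by
  rcases le_or_gt r 0 with hr | hr
  · rw [g_of_nonpos hr, mul_zero]
    rw [← lintegral_zero (μ := (volume : Measure ℝ))]
    congr 1
    ext u
    rcases le_or_gt u 0 with hu | hu
    · rw [g_of_nonpos hu, zero_mul]
    · rw [g_of_nonpos (x := r - u) (by linarith), mul_zero]
  · have hb := ProbabilityTheory.beta_pos ha hc
    have hm : Measurable fun u => g a u * g c (r - u) :=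
      (measurable_g a).mul ((measurable_g c).comp (by fun_prop))
    rw [← Real.smul_map_volume_mul_left hr.ne', lintegral_smul_measure,
      lintegral_map hm (by fun_prop)]
    have key : ∀ v, g a (r * v) * g c (r - r * v)
        = ENNReal.ofReal (r ^ (a + c - 2) * ProbabilityTheory.beta a c)
          * ProbabilityTheory.betaPDF a c v := by
      intro v
      rcases le_or_gt v 0 with hv | hv
      · rw [g_of_nonpos (by nlinarith), ProbabilityTheory.betaPDF_eq_zero_of_nonpos hv]; simp
      rcases le_or_gt 1 v with hv1 | hv1
      · rw [g_of_nonpos (x := r - r * v) (by nlinarith),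
          ProbabilityTheory.betaPDF_eq_zero_of_one_le hv1]; simp
      have h1 : 0 < 1 - v := by linarith
      rw [show r - r * v = r * (1 - v) by ring, g_of_pos (by positivity),
        g_of_pos (by positivity), ProbabilityTheory.betaPDF_of_pos_lt_one hv hv1,
        ← ENNReal.ofReal_mul (by positivity), ← ENNReal.ofReal_mul (by positivity),
        Real.mul_rpow hr.le hv.le, Real.mul_rpow hr.le h1.le,
        show a + c - 2 = (a - 1) + (c - 1) by ring, Real.rpow_add hr]
      congr 1
      field_simp
    simp_rw [key]
    rw [lintegral_const_mul' _ _ (by simp), ProbabilityTheory.lintegral_betaPDF_eq_one ha hc,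
      g_of_pos hr, abs_of_pos hr, smul_eq_mul, mul_one, ← ENNReal.ofReal_mul hr.le,
      ← ENNReal.ofReal_mul hb.le, show a + c - 1 = 1 + (a + c - 2) by ring, Real.rpow_add hr,
      Real.rpow_one]
    congr 1
    ring

lemma lint_aux (n : ℕ) : ∀ (a : Fin n → ℝ) (_ : ∀ k, 0 < a k) (c : ℝ) (_ : 0 < c) (r : ℝ),
    ∫⁻ x : Fin n → ℝ, (∏ j, g (a j) (x j)) * g c (r - ∑ j, x j)
      = ENNReal.ofReal ((∏ j, Real.Gamma (a j)) * Real.Gamma c / Real.Gamma ((∑ j, a j) + c))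
        * g ((∑ j, a j) + c) r := by
  induction n with
  | zero =>
    intro a _ c hc r
    rw [lintegral_unique]
    have := (Real.Gamma_pos_of_pos hc).ne'
    simp [this, volume_pi]
  | succ n ih =>
    intro a ha c hc r
    have hm : ∀ r : ℝ, Measurable fun x : Fin n → ℝ =>
        (∏ j, g (a j.succ) (x j)) * g c (r - ∑ j, x j) := fun r =>
      (Finset.measurable_prod _ fun j _ => (measurable_g _).comp (measurable_pi_apply j)).mul
        ((measurable_g c).comp (by fun_prop))
    have hm2 : Measurable fun z : ℝ × (Fin n → ℝ) =>
        g (a 0) z.1 * ((∏ j, g (a (Fin.succ j)) (z.2 j)) * g c ((r - z.1) - ∑ j, z.2 j)) :=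
      ((measurable_g _).comp measurable_fst).mul
       ((Finset.measurable_prod _ fun j _ => (measurable_g _).comp (by fun_prop)).mul
        ((measurable_g c).comp (by fun_prop)))
    have e := volume_preserving_piFinSuccAbove (fun _ : Fin (n + 1) => ℝ) 0
    have h1 : ∫⁻ x : Fin (n + 1) → ℝ, (∏ j, g (a j) (x j)) * g c (r - ∑ j, x j)
        = ∫⁻ z : ℝ × (Fin n → ℝ),
          g (a 0) z.1 * ((∏ j, g (a (Fin.succ j)) (z.2 j)) * g c ((r - z.1) - ∑ j, z.2 j)) := by
      rw [← e.lintegral_comp hm2]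
      congr 1
      ext x
      simp only [MeasurableEquiv.piFinSuccAbove_apply, Fin.insertNthEquiv_zero, Fin.consEquiv_symm_apply]
      rw [Fin.prod_univ_succ, Fin.sum_univ_succ, ← sub_sub, mul_assoc]
      rfl
    have hA : 0 < (∑ j : Fin n, a j.succ) + c :=
      add_pos_of_nonneg_of_pos (Finset.sum_nonneg fun j _ => (ha _).le) hc
    have hG := Real.Gamma_pos_of_pos hA
    rw [h1, Measure.volume_eq_prod, lintegral_prod _ hm2.aemeasurable]
    simp_rw [lintegral_const_mul _ (hm _), ih (fun j => a j.succ) (fun k => ha _) c hc]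
    have h2 : ∀ u, g (a 0) u * (ENNReal.ofReal ((∏ j : Fin n, Real.Gamma (a j.succ)) * Real.Gamma c / Real.Gamma ((∑ j : Fin n, a j.succ) + c)) * g ((∑ j : Fin n, a j.succ) + c) (r - u))
      = ENNReal.ofReal ((∏ j : Fin n, Real.Gamma (a j.succ)) * Real.Gamma c / Real.Gamma ((∑ j : Fin n, a j.succ) + c)) * (g (a 0) u * g ((∑ j : Fin n, a j.succ) + c) (r - u)) := by
      intro u; ring
    simp_rw [h2]
    rw [lintegral_const_mul' _ _ (by simp), conv_g (ha 0) hA, ← mul_assoc, ← ENNReal.ofReal_mul (div_nonneg (mul_nonneg (Finset.prod_nonneg fun j _ => (Real.Gamma_pos_of_pos (ha _)).le) (Real.Gamma_pos_of_pos hc).le) hG.le),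
      Fin.sum_univ_succ, Fin.prod_univ_succ, ProbabilityTheory.beta, add_assoc]
    congr 2
    field_simp

end DirEnt

namespace DirEnt

open scoped ENNReal Topology

/-- chart of the simplex -/
noncomputable def ext {n : ℕ} (x : Fin n → ℝ) : Fin (n + 1) → ℝ :=
  Fin.snoc (α := fun _ => ℝ) x (1 - ∑ j, x j)

/-- unnormalised density -/
noncomputable def W {n : ℕ} (β : Fin (n + 1) → ℝ) (x : Fin n → ℝ) : ℝ≥0∞ :=
  ∏ k, g (β k) (ext x k)

/-- unnormalised Dirichlet measure -/
noncomputable def M {n : ℕ} (β : Fin (n + 1) → ℝ) : Measure (Fin n → ℝ) :=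
  volume.withDensity (W β)

/-- its mass -/
noncomputable def D {n : ℕ} (β : Fin (n + 1) → ℝ) : ℝ :=
  (∏ k, Real.Gamma (β k)) / Real.Gamma (∑ k, β k)

lemma measurable_ext {n : ℕ} (k : Fin (n + 1)) : Measurable fun x : Fin n → ℝ => ext x k := by
  refine Fin.lastCases ?_ (fun j => ?_) k
  · simp only [ext, Fin.snoc_last]; fun_prop
  · simp only [ext, Fin.snoc_castSucc]; fun_prop

lemma measurable_W {n : ℕ} (β : Fin (n + 1) → ℝ) : Measurable (W β) :=
  Finset.measurable_prod _ fun k _ => (measurable_g _).comp (measurable_ext k)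

lemma W_lt_top {n : ℕ} (β : Fin (n + 1) → ℝ) (x : Fin n → ℝ) : W β x < ∞ := by
  refine ENNReal.prod_lt_top fun k _ => ?_
  unfold g
  split_ifs <;> simp

lemma M_univ {n : ℕ} (β : Fin (n + 1) → ℝ) (hβ : ∀ k, 0 < β k) :
    M β Set.univ = ENNReal.ofReal (D β) := by
  rw [M, withDensity_apply _ MeasurableSet.univ, Measure.restrict_univ]
  have h := lint_aux n (fun j => β j.castSucc) (fun j => hβ _) (β (Fin.last n)) (hβ _) 1
  simp only [W, Fin.prod_univ_castSucc, ext, Fin.snoc_last, Fin.snoc_castSucc]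
  rw [h, g_of_pos one_pos, Real.one_rpow, ENNReal.ofReal_one, mul_one, D, Fin.prod_univ_castSucc,
    Fin.sum_univ_castSucc]

lemma D_pos {n : ℕ} (β : Fin (n + 1) → ℝ) (hβ : ∀ k, 0 < β k) : 0 < D β :=
  div_pos (Finset.prod_pos fun k _ => Real.Gamma_pos_of_pos (hβ k))
    (Real.Gamma_pos_of_pos (Finset.sum_pos (fun k _ => hβ k) Finset.univ_nonempty))

lemma W_eq_zero {n : ℕ} (β : Fin (n + 1) → ℝ) (x : Fin n → ℝ) (h : ¬ ∀ k, 0 < ext x k) :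
    W β x = 0 := by
  push Not at h
  obtain ⟨k, hk⟩ := h
  exact Finset.prod_eq_zero (Finset.mem_univ k) (g_of_nonpos hk)

lemma W_eq {n : ℕ} (β : Fin (n + 1) → ℝ) (x : Fin n → ℝ) (h : ∀ k, 0 < ext x k) :
    W β x = ENNReal.ofReal (∏ k, ext x k ^ (β k - 1)) := by
  rw [ENNReal.ofReal_prod_of_nonneg fun k _ => (Real.rpow_pos_of_pos (h k) _).le]
  exact Finset.prod_congr rfl fun k _ => g_of_pos (h k)

lemma ae_pos {n : ℕ} (β : Fin (n + 1) → ℝ) : ∀ᵐ x ∂(M β), ∀ k, 0 < ext x k := by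
  rw [M, ae_withDensity_iff (measurable_W β)]
  refine Filter.Eventually.of_forall fun x hx => ?_
  by_contra h
  exact hx (W_eq_zero β x h)

lemma tilt {n : ℕ} (β m : Fin (n + 1) → ℝ) :
    M (β + m) = (M β).withDensity fun x => ENNReal.ofReal (∏ k, ext x k ^ m k) := by
  have hm : Measurable fun x : Fin n → ℝ => ENNReal.ofReal (∏ k, ext x k ^ m k) :=
    (Finset.measurable_prod _ fun k _ => (measurable_ext k).pow_const _).ennreal_ofReal
  rw [M, M, ← withDensity_mul _ (measurable_W β) hm]
  congr 1
  ext x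
  rw [Pi.mul_apply]
  by_cases h : ∀ k, 0 < ext x k
  · rw [W_eq _ x h, W_eq _ x h, ← ENNReal.ofReal_mul (Finset.prod_nonneg fun k _ => (Real.rpow_pos_of_pos (h k) _).le), ← Finset.prod_mul_distrib]
    congr 1
    refine Finset.prod_congr rfl fun k _ => ?_
    rw [← Real.rpow_add (h k), Pi.add_apply]
    congr 1
    ring
  · rw [W_eq_zero _ x h, W_eq_zero _ x h, zero_mul]

lemma measurable_mono {n : ℕ} (m : Fin (n + 1) → ℝ) :
    Measurable fun x : Fin n → ℝ => ENNReal.ofReal (∏ k, ext x k ^ m k) :=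
  (Finset.measurable_prod _ fun k _ => (measurable_ext k).pow_const _).ennreal_ofReal

lemma integral_tilt {n : ℕ} (β m : Fin (n + 1) → ℝ) (f : (Fin n → ℝ) → ℝ) :
    ∫ x, f x ∂(M (β + m)) = ∫ x, (∏ k, ext x k ^ m k) * f x ∂(M β) := by
  rw [tilt, integral_withDensity_eq_integral_toReal_smul (measurable_mono m) (by simp)]
  refine integral_congr_ae ?_
  filter_upwards [ae_pos β] with x hx
  rw [ENNReal.toReal_ofReal (Finset.prod_nonneg fun k _ => (Real.rpow_pos_of_pos (hx k) _).le),
    smul_eq_mul]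

lemma integrable_tilt {n : ℕ} (β m : Fin (n + 1) → ℝ) (f : (Fin n → ℝ) → ℝ) 
    (hf : Integrable f (M (β + m))) : Integrable (fun x => (∏ k, ext x k ^ m k) * f x) (M β) := by
  rw [tilt, integrable_withDensity_iff_integrable_smul' (measurable_mono m) (by simp)] at hf
  refine hf.congr ?_
  filter_upwards [ae_pos β] with x hx
  rw [ENNReal.toReal_ofReal (Finset.prod_nonneg fun k _ => (Real.rpow_pos_of_pos (hx k) _).le),
    smul_eq_mul]

lemma ae_ne {n : ℕ} : ∀ᵐ x : Fin n → ℝ, ∀ k, ext x k ≠ 0 := by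
  rw [ae_all_iff]
  intro k
  refine Fin.lastCases ?_ (fun j => ?_) k
  · simp only [ext, Fin.snoc_last]
    cases n with
    | zero => simp
    | succ n =>
      let L : (Fin (n + 1) → ℝ) →ₗ[ℝ] ℝ := ∑ j, LinearMap.proj j
      have hL : ∀ x, L x = ∑ j, x j := fun x => by simp [L]
      let s : AffineSubspace ℝ (Fin (n + 1) → ℝ) := AffineSubspace.mk' (Pi.single 0 1) (LinearMap.ker L)
      have hs : ∀ x, x ∈ s ↔ ∑ j, x j = 1 := by
        intro x
        simp only [s, AffineSubspace.mem_mk', LinearMap.mem_ker, vsub_eq_sub, hL]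
        simp [sub_eq_zero]
      have hne : s ≠ ⊤ := by
        intro h
        have : (0 : Fin (n + 1) → ℝ) ∈ s := by rw [h]; trivial
        rw [hs] at this
        simp at this
      have := Measure.addHaar_affineSubspace volume s hne
      rw [ae_iff]
      refine measure_mono_null ?_ this
      intro x hx
      simp only [Set.mem_ofPred_eq, not_not] at hx
      exact (hs x).2 (by linarith)
  · simp only [ext, Fin.snoc_castSucc]
    exact Measure.ae_eval_ne (fun _ : Fin n => (volume : Measure ℝ)) j 0

lemma extendSimplex_eq {n : ℕ} (x : Fin n → ℝ) : extendSimplex (n + 1) x = ext x := by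
  funext k
  refine Fin.lastCases ?_ (fun j => ?_) k
  · simp [ext, extendSimplex]
  · simp [ext, extendSimplex]

lemma measurableSet_chart {n : ℕ} : MeasurableSet (simplexChart (n + 1)) := by
  have h : simplexChart (n + 1) = (⋂ j, {x | 0 ≤ x j}) ∩ {x | ∑ j, x j ≤ 1} := by
    ext x; simp [simplexChart]
  rw [h]
  refine (MeasurableSet.iInter fun j => measurableSet_le measurable_const (by fun_prop)).inter
    (measurableSet_le (by fun_prop) measurable_const)

lemma dirExp_eq {n : ℕ} (α : Fin (n + 1) → ℝ) (f : (Fin (n + 1) → ℝ) → ℝ) :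
    dirExp α f = (D α)⁻¹ * ∫ x, f (ext x) ∂(M α) := by
  rw [dirExp, ← integral_indicator measurableSet_chart, M,
    integral_withDensity_eq_integral_toReal_smul (measurable_W α)
      (Filter.Eventually.of_forall (W_lt_top α)), ← integral_const_mul]
  refine integral_congr_ae (μ := (volume : Measure (Fin n → ℝ))) ?_
  filter_upwards [ae_ne (n := n)] with x hx
  have hiff : x ∈ simplexChart (n + 1) ↔ ∀ k, 0 < ext x k := by
    constructor
    · rintro ⟨h1, h2⟩ k
      refine lt_of_le_of_ne ?_ (hx k).symm
      refine Fin.lastCases ?_ (fun j => ?_) k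
      · simp only [ext, Fin.snoc_last]; exact sub_nonneg.2 h2
      · simp only [ext, Fin.snoc_castSucc]; exact h1 j
    · intro h
      refine ⟨fun j => ?_, ?_⟩
      · have := h (Fin.castSucc j)
        simp only [ext, Fin.snoc_castSucc] at this
        exact this.le
      · have := h (Fin.last n)
        simp only [ext, Fin.snoc_last] at this
        exact (sub_pos.1 this).le
  by_cases h : ∀ k, 0 < ext x k
  · rw [Set.indicator_of_mem (hiff.2 h), extendSimplex_eq, W_eq α x h, ENNReal.toReal_ofReal
      (Finset.prod_nonneg fun k _ => (Real.rpow_pos_of_pos (h k) _).le), dirDensity, D, inv_div,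
      smul_eq_mul]
    ring
  · rw [Set.indicator_of_notMem (fun hh => h (hiff.1 hh)), W_eq_zero α x h]
    simp

end DirEnt

namespace DirEnt

open scoped ENNReal Topology

/-- linear combination of logarithms -/
noncomputable def X {n : ℕ} (c : Fin (n + 1) → ℝ) (x : Fin n → ℝ) : ℝ :=
  ∑ k, c k * Real.log (ext x k)

lemma exp_X {n : ℕ} (c : Fin (n + 1) → ℝ) (x : Fin n → ℝ) (h : ∀ k, 0 < ext x k) (t : ℝ) :
    Real.exp (t * X c x) = ∏ k, ext x k ^ ((t • c) k) := by
  rw [X, Finset.mul_sum, Real.exp_sum]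
  refine Finset.prod_congr rfl fun k _ => ?_
  rw [Real.rpow_def_of_pos (h k), Pi.smul_apply, smul_eq_mul]
  congr 1
  ring

lemma isFinite_M {n : ℕ} (β : Fin (n + 1) → ℝ) (hβ : ∀ k, 0 < β k) : IsFiniteMeasure (M β) :=
  ⟨by rw [M_univ β hβ]; exact ENNReal.ofReal_lt_top⟩

lemma integrable_exp_X {n : ℕ} (β c : Fin (n + 1) → ℝ) (t : ℝ) (h : ∀ k, 0 < (β + t • c) k) :
    Integrable (fun x => Real.exp (t * X c x)) (M β) := by
  have := isFinite_M _ h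
  refine (integrable_tilt β (t • c) (fun _ => 1) (integrable_const _)).congr ?_
  filter_upwards [ae_pos β] with x hx
  rw [exp_X c x hx, mul_one]

lemma mgf_X {n : ℕ} (β c : Fin (n + 1) → ℝ) (t : ℝ) (h : ∀ k, 0 < (β + t • c) k) :
    ProbabilityTheory.mgf (X c) (M β) t = D (β + t • c) := by
  have h1 := integral_tilt β (t • c) (fun _ => 1)
  rw [integral_const, measureReal_def, M_univ _ h, ENNReal.toReal_ofReal (D_pos _ h).le, smul_eq_mul, mul_one] at h1
  rw [h1, ProbabilityTheory.mgf]
  refine integral_congr_ae ?_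
  filter_upwards [ae_pos β] with x hx
  rw [exp_X c x hx, mul_one]

lemma eventually_pos {n : ℕ} (β c : Fin (n + 1) → ℝ) (hβ : ∀ k, 0 < β k) :
    ∀ᶠ t : ℝ in 𝓝 0, ∀ k, 0 < (β + t • c) k := by
  rw [Filter.eventually_all]
  intro k
  have hc : Continuous fun t : ℝ => (β + t • c) k := by
    simp only [Pi.add_apply, Pi.smul_apply, smul_eq_mul]; fun_prop
  exact (hc.isOpen_preimage _ isOpen_Ioi).mem_nhds (by simpa using hβ k)

lemma mem_int {n : ℕ} (β c : Fin (n + 1) → ℝ) (hβ : ∀ k, 0 < β k) :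
    0 ∈ interior (ProbabilityTheory.integrableExpSet (X c) (M β)) := by
  rw [mem_interior_iff_mem_nhds]
  filter_upwards [eventually_pos β c hβ] with t ht
  exact integrable_exp_X β c t ht

/-- log mass along a line -/
noncomputable def phi {n : ℕ} (β c : Fin (n + 1) → ℝ) (t : ℝ) : ℝ :=
  (∑ k, Real.log (Real.Gamma (β k + t * c k)))
    - Real.log (Real.Gamma ((∑ k, β k) + t * ∑ k, c k))

/-- its derivative -/
noncomputable def dphi {n : ℕ} (β c : Fin (n + 1) → ℝ) (t : ℝ) : ℝ :=
  (∑ k, c k * digamma (β k + t * c k)) - (∑ k, c k) * digamma ((∑ k, β k) + t * ∑ k, c k)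

/-- its second derivative -/
noncomputable def ddphi {n : ℕ} (β c : Fin (n + 1) → ℝ) (t : ℝ) : ℝ :=
  (∑ k, c k ^ 2 * trigamma (β k + t * c k))
    - (∑ k, c k) ^ 2 * trigamma ((∑ k, β k) + t * ∑ k, c k)

lemma line_sum_pos {n : ℕ} (β c : Fin (n + 1) → ℝ) (t : ℝ) (h : ∀ k, 0 < (β + t • c) k) :
    0 < (∑ k, β k) + t * ∑ k, c k := by
  rw [Finset.mul_sum, ← Finset.sum_add_distrib]
  exact Finset.sum_pos (fun k _ => h k) Finset.univ_nonempty

lemma D_eq {n : ℕ} (β c : Fin (n + 1) → ℝ) (t : ℝ) (h : ∀ k, 0 < (β + t • c) k) :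
    D (β + t • c) = Real.exp (phi β c t) := by
  have h2 := line_sum_pos β c t h
  rw [phi, Real.exp_sub, Real.exp_sum, Real.exp_log (Real.Gamma_pos_of_pos h2), D]
  congr 1
  · exact Finset.prod_congr rfl fun k _ => (Real.exp_log (Real.Gamma_pos_of_pos (h k))).symm
  · rw [Finset.mul_sum, ← Finset.sum_add_distrib]; rfl

lemma hasDerivAt_line {f : ℝ → ℝ} {fp a b t : ℝ} (h : HasDerivAt f fp (a + t * b)) :
    HasDerivAt (fun s => f (a + s * b)) (b * fp) t := by
  have h1 : HasDerivAt (fun s : ℝ => a + s * b) b t := by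
    simpa using ((hasDerivAt_id t).mul_const b).const_add a
  rw [mul_comm]
  exact h.comp t h1

lemma hasDerivAt_phi {n : ℕ} (β c : Fin (n + 1) → ℝ) (t : ℝ) (h : ∀ k, 0 < (β + t • c) k) :
    HasDerivAt (phi β c) (dphi β c t) t :=
  (HasDerivAt.fun_sum fun k _ => hasDerivAt_line (hasDerivAt_logGamma (h k))).sub
    (hasDerivAt_line (hasDerivAt_logGamma (line_sum_pos β c t h)))

lemma hasDerivAt_dphi {n : ℕ} (β c : Fin (n + 1) → ℝ) (t : ℝ) (h : ∀ k, 0 < (β + t • c) k) :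
    HasDerivAt (dphi β c) (ddphi β c t) t := by
  have := (HasDerivAt.fun_sum (u := Finset.univ) fun k _ => (hasDerivAt_line (hasDerivAt_digamma (h k))).const_mul (c k)).sub
    ((hasDerivAt_line (hasDerivAt_digamma (line_sum_pos β c t h))).const_mul (∑ k, c k))
  refine HasDerivAt.congr_deriv (f := dphi β c) this ?_
  simp only [ddphi, sq, mul_assoc]

lemma moments {n : ℕ} (β c : Fin (n + 1) → ℝ) (hβ : ∀ k, 0 < β k) :
    ∫ x, X c x ∂(M β) = D β * dphi β c 0 ∧
    ∫ x, X c x ^ 2 ∂(M β) = D β * (ddphi β c 0 + dphi β c 0 ^ 2) := by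
  have hm := mem_int β c hβ
  have h0 : ∀ k, 0 < (β + (0 : ℝ) • c) k := by simpa using hβ
  have hD : D β = Real.exp (phi β c 0) := by rw [← D_eq β c 0 h0]; simp
  have e1 : ProbabilityTheory.mgf (X c) (M β) =ᶠ[𝓝 0] fun t => Real.exp (phi β c t) := by
    filter_upwards [eventually_pos β c hβ] with t ht
    rw [mgf_X β c t ht, D_eq β c t ht]
  have e2 : deriv (ProbabilityTheory.mgf (X c) (M β)) =ᶠ[𝓝 0]
      fun t => Real.exp (phi β c t) * dphi β c t := by
    refine e1.deriv.trans ?_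
    filter_upwards [eventually_pos β c hβ] with t ht
    exact (hasDerivAt_phi β c t ht).exp.deriv
  constructor
  · rw [← ProbabilityTheory.deriv_mgf_zero hm, e2.eq_of_nhds, hD]
  · have h2 := ProbabilityTheory.iteratedDeriv_mgf_zero hm 2
    simp only [Pi.pow_apply] at h2
    rw [← h2, iteratedDeriv_succ, iteratedDeriv_one, e2.deriv_eq,
      ((hasDerivAt_phi β c 0 h0).exp.fun_mul (hasDerivAt_dphi β c 0 h0)).deriv, hD]
    ring

lemma X_single {n : ℕ} (i : Fin (n + 1)) (x : Fin n → ℝ) :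
    X (Pi.single i 1) x = Real.log (ext x i) := by
  simp [X, Pi.single_apply]

lemma X_add {n : ℕ} (c d : Fin (n + 1) → ℝ) (x : Fin n → ℝ) :
    X (c + d) x = X c x + X d x := by
  simp [X, add_mul, Finset.sum_add_distrib]

lemma integrable_X_sq {n : ℕ} (β c : Fin (n + 1) → ℝ) (hβ : ∀ k, 0 < β k) :
    Integrable (fun x => X c x ^ 2) (M β) :=
  ProbabilityTheory.integrable_pow_of_mem_interior_integrableExpSet (mem_int β c hβ) 2

lemma integrable_log {n : ℕ} (β : Fin (n + 1) → ℝ) (hβ : ∀ k, 0 < β k) (i : Fin (n + 1)) :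
    Integrable (fun x => Real.log (ext x i)) (M β) := by
  have := ProbabilityTheory.integrable_pow_of_mem_interior_integrableExpSet
    (mem_int β (Pi.single i 1) hβ) 1
  simpa [X_single] using this

lemma integral_log {n : ℕ} (β : Fin (n + 1) → ℝ) (hβ : ∀ k, 0 < β k) (i : Fin (n + 1)) :
    ∫ x, Real.log (ext x i) ∂(M β) = D β * (digamma (β i) - digamma (∑ k, β k)) := by
  have := (moments β (Pi.single i 1) hβ).1
  simp_rw [X_single] at this
  rw [this]
  simp [dphi, Pi.single_apply]

lemma log_mul_log {n : ℕ} (i j : Fin (n + 1)) (x : Fin n → ℝ) :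
    Real.log (ext x i) * Real.log (ext x j)
      = (X (Pi.single i 1 + Pi.single j 1) x ^ 2 - X (Pi.single i 1) x ^ 2
          - X (Pi.single j 1) x ^ 2) / 2 := by
  rw [X_add, X_single, X_single]; ring

lemma integrable_log_log {n : ℕ} (β : Fin (n + 1) → ℝ) (hβ : ∀ k, 0 < β k) (i j : Fin (n + 1)) :
    Integrable (fun x => Real.log (ext x i) * Real.log (ext x j)) (M β) := by
  simp_rw [log_mul_log]
  exact (((integrable_X_sq β _ hβ).sub (integrable_X_sq β _ hβ)).sub
    (integrable_X_sq β _ hβ)).div_const 2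

lemma integral_log_log {n : ℕ} (β : Fin (n + 1) → ℝ) (hβ : ∀ k, 0 < β k) (i j : Fin (n + 1)) :
    ∫ x, Real.log (ext x i) * Real.log (ext x j) ∂(M β)
      = D β * ((if i = j then trigamma (β i) else 0) - trigamma (∑ k, β k)
        + (digamma (β i) - digamma (∑ k, β k)) * (digamma (β j) - digamma (∑ k, β k))) := by
  simp_rw [log_mul_log]
  have hsub : Integrable (fun x => X (Pi.single i 1 + Pi.single j 1) x ^ 2
      - X (Pi.single i 1) x ^ 2) (M β) := (integrable_X_sq β _ hβ).sub (integrable_X_sq β _ hβ)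
  rw [integral_div, integral_sub hsub (integrable_X_sq β _ hβ), integral_sub (integrable_X_sq β _ hβ) (integrable_X_sq β _ hβ),
    (moments β _ hβ).2, (moments β _ hβ).2, (moments β _ hβ).2]
  have h1 : ∀ i : Fin (n + 1), dphi β (Pi.single i 1) 0 = digamma (β i) - digamma (∑ k, β k) := by
    intro i; simp [dphi, Pi.single_apply]
  have h2 : ∀ i : Fin (n + 1), ddphi β (Pi.single i 1) 0 = trigamma (β i) - trigamma (∑ k, β k) := by
    intro i; simp [ddphi, Pi.single_apply]
  have h3 : dphi β (Pi.single i 1 + Pi.single j 1) 0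
      = digamma (β i) + digamma (β j) - 2 * digamma (∑ k, β k) := by
    simp [dphi, Pi.single_apply, add_mul, Finset.sum_add_distrib]; ring
  have h4 : ddphi β (Pi.single i 1 + Pi.single j 1) 0
      = trigamma (β i) + trigamma (β j) + 2 * (if i = j then trigamma (β i) else 0)
        - 4 * trigamma (∑ k, β k) := by
    have hs : ∀ k, ((Pi.single i 1 + Pi.single j 1 : Fin (n + 1) → ℝ) k) ^ 2 * trigamma (β k)
        = (if k = i then trigamma (β k) else 0) + (if k = j then trigamma (β k) else 0)
          + 2 * (if k = i then (if i = j then trigamma (β i) else 0) else 0) := by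
      intro k
      simp only [Pi.add_apply, Pi.single_apply]
      by_cases h1 : k = i
      · subst h1
        by_cases h2 : k = j
        · simp [h2]; ring
        · simp [h2]
      · simp [h1]
    simp only [ddphi, zero_mul, add_zero]
    simp_rw [hs]
    simp [Finset.sum_add_distrib]
    left
    norm_num
  rw [h1, h1, h2, h2, h3, h4]
  ring

lemma D_single {n : ℕ} (β : Fin (n + 1) → ℝ) (hβ : ∀ k, 0 < β k) (i : Fin (n + 1)) :
    D (β + Pi.single i 1) = D β * (β i / ∑ k, β k) := by
  have hs : 0 < ∑ k, β k := Finset.sum_pos (fun k _ => hβ k) Finset.univ_nonempty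
  have h1 : ∑ k, (β + Pi.single i 1 : Fin (n + 1) → ℝ) k = (∑ k, β k) + 1 := by
    simp [Finset.sum_add_distrib]
  have h2 : ∏ k, Real.Gamma ((β + Pi.single i 1 : Fin (n + 1) → ℝ) k) = (∏ k, Real.Gamma (β k)) * β i := by
    rw [← Finset.mul_prod_erase _ _ (Finset.mem_univ i),
      ← Finset.mul_prod_erase _ (fun k => Real.Gamma (β k)) (Finset.mem_univ i)]
    have : ∏ k ∈ Finset.univ.erase i, Real.Gamma ((β + Pi.single i 1 : Fin (n + 1) → ℝ) k)
        = ∏ k ∈ Finset.univ.erase i, Real.Gamma (β k) := by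
      refine Finset.prod_congr rfl fun k hk => ?_
      simp [Finset.ne_of_mem_erase hk]
    rw [this, Pi.add_apply, Pi.single_eq_same, Real.Gamma_add_one (hβ i).ne']
    ring
  have := (Real.Gamma_pos_of_pos hs).ne'
  rw [D, D, h1, h2, Real.Gamma_add_one hs.ne']
  field_simp

lemma prod_single {n : ℕ} (i : Fin (n + 1)) (x : Fin n → ℝ) :
    ∏ k, ext x k ^ ((Pi.single i 1 : Fin (n + 1) → ℝ) k) = ext x i := by
  rw [Finset.prod_eq_single i]
  · simp
  · intro k _ hk; simp [hk]
  · simp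

lemma pos_single {n : ℕ} (β : Fin (n + 1) → ℝ) (hβ : ∀ k, 0 < β k) (i : Fin (n + 1)) :
    ∀ k, 0 < (β + Pi.single i 1 : Fin (n + 1) → ℝ) k := by
  intro k
  have := hβ k
  rw [Pi.add_apply, Pi.single_apply]
  split_ifs <;> linarith

lemma sum_single {n : ℕ} (β : Fin (n + 1) → ℝ) (i : Fin (n + 1)) :
    ∑ k, (β + Pi.single i 1 : Fin (n + 1) → ℝ) k = (∑ k, β k) + 1 := by
  simp [Finset.sum_add_distrib]

lemma integrable_xlog {n : ℕ} (α : Fin (n + 1) → ℝ) (hα : ∀ k, 0 < α k) (i : Fin (n + 1)) :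
    Integrable (fun x => ext x i * Real.log (ext x i)) (M α) := by
  have := integrable_tilt α (Pi.single i 1) _ (integrable_log _ (pos_single α hα i) i)
  simpa only [prod_single] using this

lemma integral_xlog {n : ℕ} (α : Fin (n + 1) → ℝ) (hα : ∀ k, 0 < α k) (i : Fin (n + 1)) :
    ∫ x, ext x i * Real.log (ext x i) ∂(M α)
      = D α * (α i / (∑ k, α k) * (digamma (α i + 1) - digamma ((∑ k, α k) + 1))) := by
  have := integral_tilt α (Pi.single i 1) (fun x => Real.log (ext x i))
  simp only [prod_single] at this
  rw [← this, integral_log _ (pos_single α hα i), D_single α hα, sum_single, Pi.add_apply,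
    Pi.single_eq_same]
  ring

lemma integrable_xlog2 {n : ℕ} (α : Fin (n + 1) → ℝ) (hα : ∀ k, 0 < α k) (i j : Fin (n + 1)) :
    Integrable (fun x => (ext x i * Real.log (ext x i)) * (ext x j * Real.log (ext x j)))
      (M α) := by
  have := integrable_tilt α (Pi.single i 1) _ (integrable_tilt (α + Pi.single i 1) (Pi.single j 1) _
    (integrable_log_log _ (pos_single _ (pos_single α hα i) j) i j))
  simp only [prod_single] at this
  refine this.congr (Filter.Eventually.of_forall fun x => ?_)
  simp only
  ring

lemma integral_xlog2 {n : ℕ} (α : Fin (n + 1) → ℝ) (hα : ∀ k, 0 < α k) (i j : Fin (n + 1)) :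
    ∫ x, (ext x i * Real.log (ext x i)) * (ext x j * Real.log (ext x j)) ∂(M α)
      = D α * (1 / ((∑ k, α k) * ((∑ k, α k) + 1)) *
        (if i = j then α i * (α i + 1)
              * (trigamma (α i + 2) - trigamma ((∑ k, α k) + 2)
                  + (digamma (α i + 2) - digamma ((∑ k, α k) + 2)) ^ 2)
          else α i * α j
              * (-trigamma ((∑ k, α k) + 2)
                  + (digamma (α i + 1) - digamma ((∑ k, α k) + 2))
                    * (digamma (α j + 1) - digamma ((∑ k, α k) + 2))))) := by
  have hs : 0 < ∑ k, α k := Finset.sum_pos (fun k _ => hα k) Finset.univ_nonempty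
  have h := integral_tilt α (Pi.single i 1) (fun x => ext x j * (Real.log (ext x i) * Real.log (ext x j)))
  have hh := integral_tilt (α + Pi.single i 1) (Pi.single j 1) (fun x => Real.log (ext x i) * Real.log (ext x j))
  simp only [prod_single] at h hh
  have e : ∀ x : Fin n → ℝ, (ext x i * Real.log (ext x i)) * (ext x j * Real.log (ext x j))
     = ext x i * (ext x j * (Real.log (ext x i) * Real.log (ext x j))) := fun x => by ring
  simp_rw [e]
  rw [← h, ← hh, integral_log_log _ (pos_single _ (pos_single α hα i) j),
    D_single _ (pos_single α hα i), D_single α hα, sum_single, sum_single, sum_single,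
    show (∑ k, α k) + 1 + 1 = (∑ k, α k) + 2 by ring]
  by_cases hij : i = j
  · subst hij
    simp only [if_true, Pi.add_apply, Pi.single_eq_same]
    rw [show α i + 1 + 1 = α i + 2 by ring]
    field_simp
  · simp only [hij, if_false, Pi.add_apply, Pi.single_eq_same, Pi.single_eq_of_ne hij,
      Pi.single_eq_of_ne (Ne.symm hij), add_zero]
    field_simp
    ring

end DirEnt

/-- Variance of the Shannon entropy of `b ~ Dirichlet(α)`, with `Var[h] = E[h²] - (E[h])²`. -/
theorem dirichlet_entropy_variance
    (K : ℕ) (hK : 1 ≤ K) (α : Fin K → ℝ) (hα : ∀ k, 0 < α k) :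
    dirExp α (fun b => (-∑ k, b k * Real.log (b k)) ^ 2)
      - (dirExp α (fun b => -∑ k, b k * Real.log (b k))) ^ 2
      = (1 / ((∑ k, α k) * ((∑ k, α k) + 1)))
        * ((∑ i, α i * (α i + 1)
              * (trigamma (α i + 2) - trigamma ((∑ k, α k) + 2)
                  + (digamma (α i + 2) - digamma ((∑ k, α k) + 2)) ^ 2))
           + ∑ i, ∑ j ∈ Finset.univ.erase i, α i * α j
              * (-trigamma ((∑ k, α k) + 2)
                  + (digamma (α i + 1) - digamma ((∑ k, α k) + 2))
                    * (digamma (α j + 1) - digamma ((∑ k, α k) + 2))))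
        - (digamma ((∑ k, α k) + 1)
            - ∑ i, (α i / ∑ k, α k) * digamma (α i + 1)) ^ 2 := by
  obtain ⟨n, rfl⟩ : ∃ n, K = n + 1 := ⟨K - 1, by omega⟩
  have hD := (DirEnt.D_pos α hα).ne'
  have hs : 0 < ∑ k, α k := Finset.sum_pos (fun k _ => hα k) Finset.univ_nonempty
  have h1 : dirExp α (fun b => -∑ k, b k * Real.log (b k))
      = digamma ((∑ k, α k) + 1) - ∑ i, (α i / ∑ k, α k) * digamma (α i + 1) := by
    rw [DirEnt.dirExp_eq, integral_neg,
      integral_finsetSum _ (fun i _ => DirEnt.integrable_xlog α hα i)]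
    simp_rw [DirEnt.integral_xlog α hα]
    rw [← Finset.mul_sum]
    simp_rw [mul_sub]
    rw [Finset.sum_sub_distrib, ← Finset.sum_mul, ← Finset.sum_div, div_self hs.ne']
    field_simp
    ring
  have h2 : dirExp α (fun b => (-∑ k, b k * Real.log (b k)) ^ 2)
      = (1 / ((∑ k, α k) * ((∑ k, α k) + 1)))
        * ((∑ i, α i * (α i + 1)
              * (trigamma (α i + 2) - trigamma ((∑ k, α k) + 2)
                  + (digamma (α i + 2) - digamma ((∑ k, α k) + 2)) ^ 2))
           + ∑ i, ∑ j ∈ Finset.univ.erase i, α i * α j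
              * (-trigamma ((∑ k, α k) + 2)
                  + (digamma (α i + 1) - digamma ((∑ k, α k) + 2))
                    * (digamma (α j + 1) - digamma ((∑ k, α k) + 2)))) := by
    rw [DirEnt.dirExp_eq]
    simp_rw [neg_sq, sq (∑ k, _), Finset.sum_mul_sum]
    rw [integral_finsetSum _ (fun i _ => integrable_finsetSum _
      fun j _ => DirEnt.integrable_xlog2 α hα i j)]
    simp_rw [integral_finsetSum _ (fun j _ => DirEnt.integrable_xlog2 α hα _ j),
      DirEnt.integral_xlog2 α hα, ← Finset.mul_sum]
    rw [inv_mul_cancel_left₀ hD, ← Finset.sum_add_distrib]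
    congr 1
    refine Finset.sum_congr rfl fun i _ => ?_
    rw [← Finset.add_sum_erase _ _ (Finset.mem_univ i), if_pos rfl]
    congr 1
    refine Finset.sum_congr rfl fun j hj => ?_
    rw [if_neg (Finset.ne_of_mem_erase hj).symm]
  rw [h1, h2]
end
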